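/- arXiv:1509.02717 — 3 statements merged into one kernel-verified Lean document; each statement's English description precedes it below -/
import Mathlib

section
/- With the standing assumptions, suppose in addition that U = αβα₁ and V = α₂β₁α₃, where α, α₁, α₂, α₃ are nontrivial elements of A and β, β₁ are nontrivial elements of B. Then G is nontrivial. -/
open Monoid

/-- The free-product length of an element of an indexed free product: the number of letters
in its unique reduced expression as an alternating product of nontrivial elements of the
factors (the identity has length `0`). -/
noncomputable def CoprodI.length {ι : Type*} {G : ι → Type*} [∀ i, Group (G i)]
    (w : Monoid.CoprodI G) : ℕ :=
  letI := Classical.decEq ι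
  letI : ∀ i, DecidableEq (G i) := fun i => Classical.decEq (G i)
  (Monoid.CoprodI.Word.equiv w).toList.length

/-- The first two factors `A = G 0`, `B = G 1` of a triple of groups, as a family over
`Fin 2`; their free product `Monoid.CoprodI (subFamily G)` is the free product `A*B`. -/
def subFamily (G : Fin 3 → Type*) : Fin 2 → Type _ := fun i => G i.castSucc

instance (G : Fin 3 → Type*) [∀ i, Group (G i)] (i : Fin 2) : Group (subFamily G i) :=
  inferInstanceAs (Group (G i.castSucc))

/-- The canonical embedding of the free product `A*B` into the free product `A*B*C`. -/
def CoprodI.embed (G : Fin 3 → Type*) [∀ i, Group (G i)] :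
    Monoid.CoprodI (subFamily G) →* Monoid.CoprodI G :=
  Monoid.CoprodI.lift fun i => (Monoid.CoprodI.of : G i.castSucc →* Monoid.CoprodI G)


namespace P58

universe u

/-- A two-element family of groups. -/
def Fam (A C : Type u) : Bool → Type u
  | true => A
  | false => C

instance famGroup (A C : Type u) [Group A] [Group C] : ∀ b, Group (Fam A C b)
  | true => inferInstanceAs (Group A)
  | false => inferInstanceAs (Group C)

/-- Heads of words in a free product, in abstract form. -/
theorem exists_fp (A C : Type u) [Group A] [Group C] :
    ∃ (H : Type u) (_ : Group H) (Ω : Type u) (_ : MulAction H Ω) (_ : Nonempty Ω)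
      (f : A →* H) (h : C →* H) (al : Ω → A) (ga : Ω → C),
      Function.Injective f ∧ Function.Injective h ∧
      (∀ a x, al (f a • x) = a * al x) ∧ (∀ a x, ga (f a • x) = ga x) ∧
      (∀ c x, al x ≠ 1 → c ≠ 1 → al (h c • x) = 1 ∧ ga (h c • x) = c) ∧
      (∀ c x, al x = 1 → c * ga x ≠ 1 → al (h c • x) = 1 ∧ ga (h c • x) = c * ga x) ∧
      (∀ a c, c ≠ 1 → h c ≠ f a) := by
  classical
  let M := Fam A C
  let f : A →* CoprodI M := (CoprodI.of : M true →* CoprodI M)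
  let h : C →* CoprodI M := (CoprodI.of : M false →* CoprodI M)
  let al : CoprodI.Word M → M true := fun x => (CoprodI.Word.equivPair true x).head
  let re : CoprodI.Word M → CoprodI.Word M := fun x => (CoprodI.Word.equivPair true x).tail
  let ga : CoprodI.Word M → M false := fun x => (CoprodI.Word.equivPair false (re x)).head
  -- words starting with a letter of C
  have key : ∀ (c : M false) (x : CoprodI.Word M),
      c * (CoprodI.Word.equivPair false x).head ≠ 1 →
      al (h c • x) = 1 ∧ ga (h c • x) = c * (CoprodI.Word.equivPair false x).head := by
    intro c x hc
    have h1 : (CoprodI.Word.equivPair false (h c • x)) = _ :=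
      CoprodI.Word.equivPair_smul_same (M := M) (i := false) c x
    have h2 : CoprodI.Word.fstIdx (h c • x) ≠ some true := by
      have : h c • x = _ := CoprodI.Word.of_smul_def (M := M) false x c
      rw [this, CoprodI.Word.rcons, dif_neg hc, CoprodI.Word.fstIdx_cons]
      simp
    have h3 := CoprodI.Word.equivPair_eq_of_fstIdx_ne h2
    constructor
    · change (CoprodI.Word.equivPair true _).head = 1
      rw [h3]
    · change (CoprodI.Word.equivPair false (CoprodI.Word.equivPair true _).tail).head = _
      rw [h3, h1]
  refine ⟨CoprodI M, inferInstance, CoprodI.Word M, inferInstance, ⟨CoprodI.Word.empty⟩,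
    f, h, al, ga, CoprodI.of_injective (M := M) true, CoprodI.of_injective (M := M) false,
    ?_, ?_, ?_, ?_, ?_⟩
  · intro a x
    have h1 : (CoprodI.Word.equivPair true (f a • x)) = _ :=
      CoprodI.Word.equivPair_smul_same (M := M) (i := true) a x
    change (CoprodI.Word.equivPair true (f a • x)).head = _
    rw [h1]
    rfl
  · intro a x
    have h1 : (CoprodI.Word.equivPair true (f a • x)) = _ :=
      CoprodI.Word.equivPair_smul_same (M := M) (i := true) a x
    change (CoprodI.Word.equivPair false (CoprodI.Word.equivPair true _).tail).head = _
    rw [h1]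
  · intro c x hx hc
    have h0 : CoprodI.Word.fstIdx x ≠ some false := by
      have hr : CoprodI.Word.rcons (CoprodI.Word.equivPair true x) = x :=
        (CoprodI.Word.equivPair true).symm_apply_apply x
      rw [← hr, CoprodI.Word.rcons, dif_neg (show ¬ (CoprodI.Word.equivPair true x).head = 1 from hx),
        CoprodI.Word.fstIdx_cons]
      simp
    have h1 := CoprodI.Word.equivPair_eq_of_fstIdx_ne h0
    have h2 := key c x (by rw [h1]; exact fun e => hc ((mul_one c).symm.trans e))
    rw [h1] at h2
    exact ⟨h2.1, h2.2.trans (mul_one c)⟩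
  · intro c x hx hc
    have hr : CoprodI.Word.rcons (CoprodI.Word.equivPair true x) = x :=
      (CoprodI.Word.equivPair true).symm_apply_apply x
    have : re x = x := by
      conv_rhs => rw [← hr, CoprodI.Word.rcons,
        dif_pos (show (CoprodI.Word.equivPair true x).head = 1 from hx)]
    have hg : ga x = (CoprodI.Word.equivPair false x).head := by
      change (CoprodI.Word.equivPair false (re x)).head = _
      rw [this]
    rw [hg] at hc ⊢
    exact key c x hc
  · intro a c hc e
    let k : ∀ b, M b →* C := fun b => match b with
      | true => (1 : A →* C)
      | false => MonoidHom.id C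
    have e1 : CoprodI.lift k (h c) = c := CoprodI.lift_of k (i := false) c
    have e2 : CoprodI.lift k (f a) = 1 := CoprodI.lift_of k (i := true) a
    rw [e, e2] at e1
    exact hc e1.symm

/-- Ping-pong data for the pair `P, Q`, making `⟨P, Q⟩` the free product of the infinite cyclic
group `⟨P⟩` and of `⟨Q⟩`. -/
def PP {H : Type u} [Group H] (P Q : H) : Prop :=
  ∃ (Ω : Type u) (_ : MulAction H Ω) (SP SQ : Set Ω), SP.Nonempty ∧ Disjoint SP SQ ∧
    (∀ i : ℤ, i ≠ 0 → ∀ x ∈ SQ, P ^ i • x ∈ SP) ∧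
    (∀ j : ℤ, Q ^ j ≠ 1 → ∀ x ∈ SP, Q ^ j • x ∈ SQ)

theorem PP.inv_left {H : Type u} [Group H] {P Q : H} (h : PP P Q) : PP P⁻¹ Q := by
  obtain ⟨Ω, i, SP, SQ, h1, h2, h3, h4⟩ := h
  refine ⟨Ω, i, SP, SQ, h1, h2, fun i hi x hx => ?_, h4⟩
  have := h3 (-i) (by omega) x hx
  rwa [zpow_neg, ← inv_zpow] at this

theorem PP.inv_right {H : Type u} [Group H] {P Q : H} (h : PP P Q) : PP P Q⁻¹ := by
  obtain ⟨Ω, i, SP, SQ, h1, h2, h3, h4⟩ := h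
  refine ⟨Ω, i, SP, SQ, h1, h2, h3, fun i hi x hx => ?_⟩
  rw [inv_zpow, ← zpow_neg] at hi ⊢
  exact h4 _ hi x hx

theorem pow_step {H Ω : Type u} [Group H] [MulAction H Ω] (P : H) (R N S : Set Ω)
    (hR : ∀ x, x ∉ N → P • x ∈ R) (hN : ∀ x, x ∉ R → P⁻¹ • x ∈ N)
    (hRN : ∀ x, x ∈ R → x ∉ N) (hS : ∀ x ∈ S, x ∉ R ∧ x ∉ N) :
    ∀ i : ℤ, i ≠ 0 → ∀ x ∈ S, P ^ i • x ∈ R ∪ N := by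
  have hp : ∀ n : ℕ, ∀ x ∈ S, P ^ (n + 1) • x ∈ R := by
    intro n x hx
    induction n with
    | zero => simpa using hR x (hS x hx).2
    | succ n ih => rw [pow_succ', mul_smul]; exact hR _ (hRN _ ih)
  have hn : ∀ n : ℕ, ∀ x ∈ S, P⁻¹ ^ (n + 1) • x ∈ N := by
    intro n x hx
    induction n with
    | zero => simpa using hN x (hS x hx).1
    | succ n ih => rw [pow_succ', mul_smul]; exact hN _ (fun h => hRN _ h ih)
  intro i hi x hx
  rcases lt_or_gt_of_ne hi with h | h
  · obtain ⟨n, rfl⟩ : ∃ n : ℕ, i = -((n + 1 : ℕ) : ℤ) := ⟨(-i - 1).toNat, by omega⟩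
    right
    rw [zpow_neg, ← inv_zpow, zpow_natCast]
    exact hn n x hx
  · obtain ⟨n, rfl⟩ : ∃ n : ℕ, i = ((n + 1 : ℕ) : ℤ) := ⟨(i - 1).toNat, by omega⟩
    left
    rw [zpow_natCast]
    exact hp n x hx

/-- Two kinds of ping-pong data in a free product. -/
theorem exists_fp_pp (A C : Type u) [Group A] [Group C] :
    ∃ (H : Type u) (_ : Group H) (f : A →* H) (h : C →* H),
      Function.Injective f ∧ Function.Injective h ∧
      (∀ (s t u v : A) (c₁ c₂ : C), c₁ ≠ 1 → c₂ ≠ 1 → s ≠ t → s ≠ u → s ≠ v → t ≠ u → u ≠ v →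
        (t ≠ v ∨ c₁ ≠ c₂) →
        PP (f u⁻¹ * h c₂ * f v) (f s⁻¹ * h c₁ * f t)) ∧
      (∀ (u v : A) (c₁ c₂ : C), c₁ ≠ 1 → c₂ ≠ 1 → u ≠ v → v ≠ 1 →
        (u ≠ 1 ∨ ∀ j : ℤ, c₁ ^ j ≠ c₂) →
        PP (f u⁻¹ * h c₂ * f v) (h c₁)) ∧
      (∀ a c, c ≠ 1 → h c ≠ f a) := by
  obtain ⟨H, _, Ω, _, ⟨x₀⟩, f, h, al, ga, hf, hh, h1, h2, h3, h4, h5⟩ := exists_fp A C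
  have stepA : ∀ (u v : A) (c : C) (x : Ω), c ≠ 1 → al x ≠ v⁻¹ →
      al ((f u⁻¹ * h c * f v) • x) = u⁻¹ ∧ ga ((f u⁻¹ * h c * f v) • x) = c := by
    intro u v c x hc hx
    rw [mul_smul, mul_smul, h1, h2]
    have : al (f v • x) ≠ 1 := by
      rw [h1]; intro h; exact hx (eq_inv_of_mul_eq_one_right h)
    obtain ⟨e1, e2⟩ := h3 c _ this hc
    rw [e1, e2]; simp
  have stepB : ∀ (u v : A) (c : C) (x : Ω), c ≠ 1 → (al x = v⁻¹ → ga x ≠ c⁻¹) →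
      al ((f u⁻¹ * h c * f v) • x) = u⁻¹ := by
    intro u v c x hc hx
    by_cases hv : al x = v⁻¹
    · have hg := hx hv
      rw [mul_smul, mul_smul, h1]
      have e1 : al (f v • x) = 1 := by rw [h1, hv]; simp
      have e2 : c * ga (f v • x) ≠ 1 := by
        rw [h2]; intro h; exact hg (eq_inv_of_mul_eq_one_right h)
      rw [(h4 c _ e1 e2).1]; simp
    · exact (stepA u v c x hc hv).1
  have hinv : ∀ (u v : A) (c : C), (f u⁻¹ * h c * f v)⁻¹ = f v⁻¹ * h c⁻¹ * f u := by
    intro u v c; simp [mul_assoc]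
  refine ⟨H, inferInstance, f, h, hf, hh, ?_, ?_, h5⟩
  · intro s t u v c₁ c₂ hc₁ hc₂ st su sv tu uv tv
    let R₁ : Set Ω := {x | al x = s⁻¹}
    let N₁ : Set Ω := {x | al x = t⁻¹ ∧ ga x = c₁⁻¹}
    let R₂ : Set Ω := {x | al x = u⁻¹}
    let N₂ : Set Ω := {x | al x = v⁻¹ ∧ ga x = c₂⁻¹}
    have d : ∀ x, x ∈ R₁ ∪ N₁ → x ∉ R₂ ∧ x ∉ N₂ := by
      rintro x (hx | ⟨hx, hx'⟩)
      · refine ⟨fun h => su ?_, fun h => sv ?_⟩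
        · exact inv_injective (hx.symm.trans h)
        · exact inv_injective (hx.symm.trans h.1)
      · refine ⟨fun h => tu ?_, fun h => ?_⟩
        · exact inv_injective (hx.symm.trans h)
        · rcases tv with tv | tv
          · exact tv (inv_injective (hx.symm.trans h.1))
          · exact tv (inv_injective (hx'.symm.trans h.2))
    have r₁ : ∀ x, x ∉ N₁ → (f s⁻¹ * h c₁ * f t) • x ∈ R₁ := fun x hx =>
      stepB s t c₁ x hc₁ (fun e e' => hx ⟨e, e'⟩)
    have r₂ : ∀ x, x ∉ N₂ → (f u⁻¹ * h c₂ * f v) • x ∈ R₂ := fun x hx =>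
      stepB u v c₂ x hc₂ (fun e e' => hx ⟨e, e'⟩)
    have n₁ : ∀ x, x ∉ R₁ → (f s⁻¹ * h c₁ * f t)⁻¹ • x ∈ N₁ := fun x hx => by
      rw [hinv]; exact stepA t s c₁⁻¹ x (inv_ne_one.mpr hc₁) hx
    have n₂ : ∀ x, x ∉ R₂ → (f u⁻¹ * h c₂ * f v)⁻¹ • x ∈ N₂ := fun x hx => by
      rw [hinv]; exact stepA v u c₂⁻¹ x (inv_ne_one.mpr hc₂) hx
    refine ⟨Ω, inferInstance, R₂ ∪ N₂, R₁ ∪ N₁, ?_, ?_, ?_, ?_⟩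
    · by_cases hx : x₀ ∈ N₂
      · exact ⟨x₀, Or.inr hx⟩
      · exact ⟨_, Or.inl (r₂ _ hx)⟩
    · rw [Set.disjoint_left]
      rintro x (hx | hx) h
      · exact (d x h).1 hx
      · exact (d x h).2 hx
    · exact pow_step _ R₂ N₂ _ r₂ n₂
        (fun x hx hx' => uv (inv_injective (hx.symm.trans hx'.1))) d
    · intro j hj
      refine pow_step _ R₁ N₁ _ r₁ n₁
        (fun x hx hx' => st (inv_injective (hx.symm.trans hx'.1))) ?_ j ?_
      · intro x hx
        refine ⟨fun h => ?_, fun h => ?_⟩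
        · exact hx.elim (d x (Or.inl h)).1 (d x (Or.inl h)).2
        · exact hx.elim (d x (Or.inr h)).1 (d x (Or.inr h)).2
      · rintro rfl; simp at hj
  · intro u v c₁ c₂ hc₁ hc₂ uv v1 hu
    let R : Set Ω := {x | al x = u⁻¹ ∧ ga x = c₂}
    let N : Set Ω := {x | al x = v⁻¹}
    let S : Set Ω := {x | al x = 1 ∧ (u = 1 → ga x ≠ c₂)}
    have r : ∀ x, x ∉ N → (f u⁻¹ * h c₂ * f v) • x ∈ R := fun x hx => stepA u v c₂ x hc₂ hx
    have n : ∀ x, x ∉ R → (f u⁻¹ * h c₂ * f v)⁻¹ • x ∈ N := fun x hx => by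
      rw [hinv]
      exact stepB v u c₂⁻¹ x (inv_ne_one.mpr hc₂) (fun e e' => hx ⟨e, by simpa using e'⟩)
    have d : ∀ x ∈ S, x ∉ R ∧ x ∉ N := by
      rintro x ⟨hx, hx'⟩
      refine ⟨fun h => ?_, fun h => v1 ?_⟩
      · have : u = 1 := by simpa using (h.1.symm.trans hx)
        exact hx' this h.2
      · simpa using (Eq.symm h).trans hx
    refine ⟨Ω, inferInstance, R ∪ N, S, ?_, ?_, ?_, ?_⟩
    · by_cases hx : x₀ ∈ N
      · exact ⟨x₀, Or.inr hx⟩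
      · exact ⟨_, Or.inl (r _ hx)⟩
    · rw [Set.disjoint_left]
      rintro x (hx | hx) h
      · exact (d x h).1 hx
      · exact (d x h).2 hx
    · exact pow_step _ R N _ r n
        (fun x hx hx' => uv (inv_injective (hx.1.symm.trans hx'))) d
    · intro j hj x hx
      rw [← map_zpow] at hj ⊢
      have hj' : c₁ ^ j ≠ 1 := fun e => hj (by rw [e, map_one])
      by_cases ha : al x = 1
      · rcases hx with hx | hx
        · have u1 : u = 1 := by simpa using (hx.1.symm.trans ha)
          have hu' := hu.resolve_left (fun h => h u1)
          have e : c₁ ^ j * ga x ≠ 1 := by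
            rw [hx.2]; intro e
            apply hu' (-j)
            rw [zpow_neg]; exact (eq_inv_of_mul_eq_one_right e).symm
          obtain ⟨e1, e2⟩ := h4 _ x ha e
          refine ⟨e1, fun _ => ?_⟩
          rw [e2, hx.2]
          simpa using hj'
        · exact absurd (by simpa using (Eq.symm hx).trans ha) v1
      · obtain ⟨e1, e2⟩ := h3 _ x ha hj'
        refine ⟨e1, fun u1 => ?_⟩
        rw [e2]
        exact hu.resolve_left (fun h => h u1) j

/-- Amalgamated products of two groups. -/
theorem glue {E : Type u} {G₁ G₂ : Type u} [Group E] [Group G₁] [Group G₂] (f : E →* G₁)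
    (g : E →* G₂) (hf : Function.Injective f) (hg : Function.Injective g) :
    ∃ (K : Type u) (_ : Group K) (i : G₁ →* K) (j : G₂ →* K),
      Function.Injective i ∧ Function.Injective j ∧ ∀ e, i (f e) = j (g e) := by
  let φ : ∀ b, E →* Fam G₁ G₂ b := fun b => match b with
    | true => f
    | false => g
  have hφ : ∀ b, Function.Injective (φ b) := fun b => match b with
    | true => hf
    | false => hg
  refine ⟨PushoutI φ, inferInstance, (PushoutI.of true : Fam G₁ G₂ true →* PushoutI φ),
    (PushoutI.of false : Fam G₁ G₂ false →* PushoutI φ),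
    PushoutI.of_injective hφ true, PushoutI.of_injective hφ false, fun e => ?_⟩
  exact (PushoutI.of_apply_eq_base φ true e).trans (PushoutI.of_apply_eq_base φ false e).symm

theorem glue_zpowers {G₁ G₂ : Type u} [Group G₁] [Group G₂] (x : G₁) (y : G₂)
    (h : ∀ m : ℤ, x ^ m = 1 ↔ y ^ m = 1) :
    ∃ (K : Type u) (_ : Group K) (i : G₁ →* K) (j : G₂ →* K),
      Function.Injective i ∧ Function.Injective j ∧ i x = j y := by
  let z : G₁ × G₂ := (x, y)
  let E := Subgroup.zpowers z
  obtain ⟨K, _, i, j, hi, hj, e⟩ := glue ((MonoidHom.fst G₁ G₂).comp E.subtype)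
    ((MonoidHom.snd G₁ G₂).comp E.subtype)
    (by
      rw [injective_iff_map_eq_one]
      rintro ⟨_, m, rfl⟩ hm
      have hm : x ^ m = 1 := hm
      exact Subtype.ext (Prod.ext hm ((h m).1 hm)))
    (by
      rw [injective_iff_map_eq_one]
      rintro ⟨_, m, rfl⟩ hm
      have hm : y ^ m = 1 := hm
      exact Subtype.ext (Prod.ext ((h m).2 hm) hm))
  exact ⟨K, inferInstance, i, j, hi, hj, e ⟨z, Subgroup.mem_zpowers z⟩⟩

theorem pp_ne {H : Type u} [Group H] {P Q : H} (h : PP P Q) (hQ : Q ≠ 1) :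
    ∀ i : ℤ, i ≠ 0 → P ^ i ≠ 1 := by
  obtain ⟨Ω, _, SP, SQ, ⟨x, hx⟩, h2, h3, h4⟩ := h
  intro i hi e
  have hy := h4 1 (by simpa using hQ) x hx
  have := h3 i hi _ hy
  rw [e, one_smul] at this
  exact Set.disjoint_left.mp h2 this hy

open Cardinal in
theorem pp_inj {H L : Type u} [Group H] [Group L] {P Q : H} (h : PP P Q) (hQ : Q ≠ 1)
    (g : Bool → L) (F : ∀ b, Subgroup.zpowers (g b) →* H)
    (h1 : ∀ b, F b ⟨g b, Subgroup.mem_zpowers _⟩ = if b then P else Q)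
    (h0 : ∀ j : ℤ, Q ^ j = 1 → g false ^ j = 1) :
    Function.Injective (CoprodI.lift F) := by
  have hP := pp_ne h hQ
  obtain ⟨Ω, _, SP, SQ, ⟨x, hx⟩, h2, h3, h4⟩ := h
  have hF : ∀ b (m : ℤ), F b ⟨g b ^ m, m, rfl⟩ = (if b then P else Q) ^ m := by
    intro b m
    rw [← h1, ← map_zpow]
    rfl
  refine CoprodI.lift_injective_of_ping_pong F ?_ (fun b => if b then SP else SQ) ?_ ?_ ?_
  · right
    refine ⟨true, ?_⟩
    have hinj : Function.Injective (fun m : ℤ => (⟨g true ^ m, m, rfl⟩ : Subgroup.zpowers (g true))) := by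
      intro m n hmn
      have := congrArg (F true) hmn
      simp only [hF, if_true] at this
      by_contra hne
      apply hP (m - n) (by omega)
      rw [zpow_sub, this, mul_inv_cancel]
    have : Infinite (Subgroup.zpowers (g true)) := Infinite.of_injective _ hinj
    exact le_trans (by exact_mod_cast (Cardinal.natCast_lt_aleph0 (n := 3)).le) (Cardinal.aleph0_le_mk _)
  · rintro (_ | _)
    · exact ⟨_, h4 1 (by simpa using hQ) x hx⟩
    · exact ⟨x, hx⟩
  · rintro (_ | _) (_ | _) hne
    · exact absurd rfl hne
    · exact h2.symm
    · exact h2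
    · exact absurd rfl hne
  · rintro (_ | _) (_ | _) hne
    · exact absurd rfl hne
    · rintro ⟨_, m, rfl⟩ hm
      rw [hF]
      rintro _ ⟨y, hy, rfl⟩
      refine h4 m ?_ y hy
      intro e
      exact hm (Subtype.ext (h0 m e))
    · rintro ⟨_, m, rfl⟩ hm
      rw [hF]
      rintro _ ⟨y, hy, rfl⟩
      refine h3 m ?_ y hy
      rintro rfl
      exact hm (Subtype.ext (zpow_zero _))
    · exact absurd rfl hne

/-- Gluing along a free product of two cyclic groups. -/
theorem glue_pp {H L : Type u} [Group H] [Group L] {P Q : H} {P' Q' : L} (h : PP P Q)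
    (h' : PP P' Q') (hQ : Q ≠ 1) (hQQ : ∀ j : ℤ, Q ^ j = 1 ↔ Q' ^ j = 1) :
    ∃ (K : Type u) (_ : Group K) (i : H →* K) (j : L →* K),
      Function.Injective i ∧ Function.Injective j ∧ i P = j P' ∧ i Q = j Q' := by
  have hQ' : Q' ≠ 1 := fun e => hQ (by simpa using (hQQ 1).2 (by simpa using e))
  let g : Bool → H × L := fun b => if b then (P, P') else (Q, Q')
  let F₁ : ∀ b, Subgroup.zpowers (g b) →* H := fun b =>
    (MonoidHom.fst H L).comp (Subgroup.zpowers (g b)).subtype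
  let F₂ : ∀ b, Subgroup.zpowers (g b) →* L := fun b =>
    (MonoidHom.snd H L).comp (Subgroup.zpowers (g b)).subtype
  have e1 : ∀ b, F₁ b ⟨g b, Subgroup.mem_zpowers _⟩ = if b then P else Q := by
    rintro (_ | _) <;> rfl
  have e2 : ∀ b, F₂ b ⟨g b, Subgroup.mem_zpowers _⟩ = if b then P' else Q' := by
    rintro (_ | _) <;> rfl
  obtain ⟨K, _, i, j, hi, hj, e⟩ := glue (CoprodI.lift F₁) (CoprodI.lift F₂)
    (pp_inj h hQ g F₁ e1 (fun j hj => Prod.ext hj ((hQQ j).1 hj)))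
    (pp_inj h' hQ' g F₂ e2 (fun j hj => Prod.ext ((hQQ j).2 hj) hj))
  refine ⟨K, inferInstance, i, j, hi, hj, ?_, ?_⟩
  · have := e (CoprodI.of (i := true) ⟨g true, Subgroup.mem_zpowers _⟩)
    rwa [CoprodI.lift_of, CoprodI.lift_of, e1, e2] at this
  · have := e (CoprodI.of (i := false) ⟨g false, Subgroup.mem_zpowers _⟩)
    rwa [CoprodI.lift_of, CoprodI.lift_of, e1, e2] at this

/-- Solving `β P β₁ Q = 1` over `H * B`. -/
theorem solve_pp {H B : Type u} [Group H] [Group B] {P Q : H} (h : PP P Q) (hQ : Q ≠ 1)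
    (b₁ b₂ : B) (hb₁ : b₁ ≠ 1) (hb₂ : b₂ ≠ 1) (hb : b₁ * b₂ ≠ 1) :
    ∃ (K : Type u) (_ : Group K) (i : H →* K) (j : B →* K),
      Function.Injective i ∧ Function.Injective j ∧ j b₁ * i P * j b₂ * i Q = 1 := by
  obtain ⟨L, _, f, k, hf, hk, -, F2, -⟩ := exists_fp_pp B H
  have h' := F2 b₁ b₂⁻¹ Q Q⁻¹ hQ (inv_ne_one.mpr hQ)
    (fun e => hb (by rw [e, inv_mul_cancel])) (inv_ne_one.mpr hb₂) (Or.inl hb₁)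
  obtain ⟨K, _, i, j, hi, hj, eP, eQ⟩ := glue_pp h h' hQ (fun m => by
    rw [← map_zpow, map_eq_one_iff k hk])
  refine ⟨K, inferInstance, i, j.comp f, hi, hj.comp hf, ?_⟩
  rw [eP, eQ]
  simp [mul_assoc]


section matrices

open Matrix

/-- Chebyshev-type coefficient. -/
noncomputable def cheb (l : ℂ) (m : ℤ) : ℂ := (l ^ m - l⁻¹ ^ m) / (l - l⁻¹)

theorem cheb_rec (l : ℂ) (hl : l ≠ 0) (m : ℤ) :
    cheb l (m + 1) = (l + l⁻¹) * cheb l m - cheb l (m - 1) := by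
  unfold cheb
  have hl' : l⁻¹ ≠ 0 := inv_ne_zero hl
  rw [_root_.zpow_add_one₀ hl, _root_.zpow_add_one₀ hl', _root_.zpow_sub_one₀ hl, _root_.zpow_sub_one₀ hl', mul_div_assoc',
    ← sub_div]
  congr 1
  field_simp
  ring

theorem cheb_zero (l : ℂ) : cheb l 0 = 0 := by simp [cheb]

theorem sub_inv_ne {l : ℂ} (hl : l ≠ 0) (hl2 : l ^ 2 ≠ 1) : l - l⁻¹ ≠ 0 := by
  intro h
  apply hl2
  have : l = l⁻¹ := sub_eq_zero.mp h
  rw [pow_two]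
  nth_rewrite 2 [this]
  exact mul_inv_cancel₀ hl

theorem cheb_one {l : ℂ} (hl : l ≠ 0) (hl2 : l ^ 2 ≠ 1) : cheb l 1 = 1 := by
  simp [cheb, sub_inv_ne hl hl2]

theorem cheb_neg_one {l : ℂ} (hl : l ≠ 0) (hl2 : l ^ 2 ≠ 1) : cheb l (-1) = -1 := by
  have := cheb_rec l hl 0
  rw [cheb_zero, zero_add, cheb_one hl hl2] at this
  simp only [mul_zero, zero_sub] at this
  rw [this]; simp

theorem cheb_eq_zero {l : ℂ} (hl : l ≠ 0) (hl2 : l ^ 2 ≠ 1) (m : ℤ) :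
    cheb l m = 0 ↔ (l ^ 2) ^ m = 1 := by
  unfold cheb
  rw [div_eq_zero_iff, or_iff_left (sub_inv_ne hl hl2), sub_eq_zero, _root_.inv_zpow,
    ← mul_eq_one_iff_eq_inv₀ (zpow_ne_zero m hl), ← mul_zpow, pow_two]

abbrev SL2 := Matrix.SpecialLinearGroup (Fin 2) ℂ

theorem sl2_sq (z : SL2) : (z : Matrix (Fin 2) (Fin 2) ℂ) * z =
    (trace (z : Matrix (Fin 2) (Fin 2) ℂ)) • (z : Matrix (Fin 2) (Fin 2) ℂ) - 1 := by
  have h := z.det_coe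
  rw [det_fin_two] at h
  ext i j
  fin_cases i <;> fin_cases j <;> simp [Matrix.mul_apply, trace_fin_two, Fin.sum_univ_two] <;>
    first | linear_combination -h | ring

theorem sl2_zpow (z : SL2) (l : ℂ) (hl : l ≠ 0) (hl2 : l ^ 2 ≠ 1)
    (ht : trace (z : Matrix (Fin 2) (Fin 2) ℂ) = l + l⁻¹) (m : ℤ) :
    ((z ^ m : SL2) : Matrix (Fin 2) (Fin 2) ℂ) =
      cheb l m • (z : Matrix (Fin 2) (Fin 2) ℂ) - cheb l (m - 1) • 1 := by
  have hsq := sl2_sq z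
  rw [ht] at hsq
  have hz : (z : Matrix (Fin 2) (Fin 2) ℂ) * ((z⁻¹ : SL2) : Matrix (Fin 2) (Fin 2) ℂ) = 1 := by
    rw [← Matrix.SpecialLinearGroup.coe_mul, mul_inv_cancel, Matrix.SpecialLinearGroup.coe_one]
  have hinv : ((z⁻¹ : SL2) : Matrix (Fin 2) (Fin 2) ℂ) =
      (l + l⁻¹) • 1 - (z : Matrix (Fin 2) (Fin 2) ℂ) := by
    have := congrArg (fun M => M * ((z⁻¹ : SL2) : Matrix (Fin 2) (Fin 2) ℂ)) hsq
    simp only [mul_assoc, sub_mul, smul_mul_assoc, hz, mul_one, one_mul] at this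
    rw [this]; abel
  induction m using Int.induction_on with
  | zero => simp [cheb_zero, cheb_neg_one hl hl2]
  | succ n ih =>
    rw [_root_.zpow_add_one, Matrix.SpecialLinearGroup.coe_mul, ih, sub_mul, smul_mul_assoc, hsq, smul_mul_assoc,
      one_mul, cheb_rec l hl, add_sub_cancel_right]
    module
  | pred n ih =>
    have hr := cheb_rec l hl (-(n : ℤ) - 1)
    rw [sub_add_cancel] at hr
    rw [_root_.zpow_sub_one, Matrix.SpecialLinearGroup.coe_mul, ih, sub_mul, smul_mul_assoc, hz, smul_mul_assoc,
      one_mul, hinv, hr]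
    module

theorem sl2_order (z : SL2) (l : ℂ) (hl : l ≠ 0) (hl2 : l ^ 2 ≠ 1)
    (ht : trace (z : Matrix (Fin 2) (Fin 2) ℂ) = l + l⁻¹) (m : ℤ) :
    z ^ m ∈ Subgroup.center SL2 ↔ (l ^ 2) ^ m = 1 := by
  have hz := sl2_zpow z l hl hl2 ht m
  rw [← cheb_eq_zero hl hl2, Matrix.SpecialLinearGroup.mem_center_iff]
  constructor
  · rintro ⟨r, -, hr⟩
    by_contra hc
    rw [hz] at hr
    have h00 := congrFun (congrFun hr 0) 0
    have h01 := congrFun (congrFun hr 0) 1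
    have h10 := congrFun (congrFun hr 1) 0
    have h11 := congrFun (congrFun hr 1) 1
    simp at h00 h01 h10 h11
    have h01 := h01.resolve_left hc
    have h10 := h10.resolve_left hc
    have hd : z.1 0 0 = z.1 1 1 := by
      apply mul_left_cancel₀ hc
      linear_combination h11 - h00
    have hdet := z.det_coe
    rw [det_fin_two] at hdet
    rw [trace_fin_two] at ht
    simp only [h01, h10] at hdet
    have e1 : (l - l⁻¹) ^ 2 = 0 := by
      have : l * l⁻¹ = 1 := mul_inv_cancel₀ hl
      have h5 : 2 * z.1 0 0 = l + l⁻¹ := by rw [← ht, two_mul]; nth_rewrite 2 [hd]; rfl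
      have h6 : z.1 0 0 * z.1 0 0 = 1 := by
        nth_rewrite 2 [hd]; simpa using hdet
      linear_combination (-(l + l⁻¹) - 2 * z.1 0 0) * h5 + 4 * h6 - 4 * this
    exact sub_inv_ne hl hl2 (pow_eq_zero_iff (two_ne_zero)|>.mp e1)
  · intro hc
    rw [hc, zero_smul, zero_sub] at hz
    refine ⟨-cheb l (m - 1), ?_, ?_⟩
    · have := (z ^ m).det_coe
      rw [hz, ← neg_smul, det_smul, det_one, mul_one] at this
      exact this
    · rw [hz]
      ext i j
      fin_cases i <;> fin_cases j <;> simp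

theorem exists_root {A : Type*} [Group A] (a : A) (ha : a ≠ 1) :
    ∃ l : ℂ, l ≠ 0 ∧ l ^ 2 ≠ 1 ∧ ∀ m : ℤ, (l ^ 2) ^ m = 1 ↔ a ^ m = 1 := by
  have key : ∃ l : ℂ, l ≠ 0 ∧ ∀ m : ℤ, (l ^ 2) ^ m = 1 ↔ a ^ m = 1 := by
    by_cases h0 : orderOf a = 0
    · refine ⟨2, two_ne_zero, fun m => ?_⟩
      rw [← orderOf_dvd_iff_zpow_eq_one, h0]
      simp only [Nat.cast_zero, zero_dvd_iff]
      constructor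
      · intro h
        have h' := congrArg norm h
        rw [norm_zpow, norm_pow] at h'
        norm_num at h'
        have := (zpow_eq_one_iff_right₀ (a := (4 : ℝ)) (by norm_num) (by norm_num)).mp h'
        exact this
      · rintro rfl; simp
    · have hp := Complex.isPrimitiveRoot_exp (orderOf a) h0
      set w := Complex.exp (2 * Real.pi * Complex.I / (orderOf a)) with hw
      refine ⟨Complex.exp (2 * Real.pi * Complex.I / (orderOf a) / 2), Complex.exp_ne_zero _,
        fun m => ?_⟩
      rw [← Complex.exp_nat_mul]
      have : ((2 : ℕ) : ℂ) * (2 * Real.pi * Complex.I / (orderOf a) / 2) =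
        2 * Real.pi * Complex.I / (orderOf a) := by push_cast; ring
      rw [this, ← hw, hp.zpow_eq_one_iff_dvd, orderOf_dvd_iff_zpow_eq_one]
  obtain ⟨l, h0, h⟩ := key
  refine ⟨l, h0, fun e => ha ?_, h⟩
  simpa using (h 1).1 (by simpa using e)

/-- Elements with prescribed orders in `PSL₂(ℂ)`. -/
theorem exists_psl {A B C : Type*} [Group A] [Group B] [Group C] (a : A) (x : B) (y : C) (i j : ℤ)
    (ha : a ≠ 1) (hx : x ≠ 1) (hy : y ≠ 1)
    (hij : (x ^ i ≠ 1 ∧ y ^ j ≠ 1) ∨ (i = 0 ∧ j = 0)) :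
    ∃ (X Y Z : SL2 ⧸ Subgroup.center SL2), X * Y * X ^ i * Z * Y ^ j = 1 ∧
      (∀ m : ℤ, Z ^ m = 1 ↔ a ^ m = 1) ∧ (∀ m : ℤ, X ^ m = 1 ↔ x ^ m = 1) ∧
      (∀ m : ℤ, Y ^ m = 1 ↔ y ^ m = 1) := by
  obtain ⟨n, n0, n2, hn⟩ := exists_root a ha
  obtain ⟨l, l0, l2, hl⟩ := exists_root x hx
  obtain ⟨k, k0, k2, hk⟩ := exists_root y hy
  -- the matrices
  let X : SL2 := ⟨!![l, 1; 0, l⁻¹], by simp [det_fin_two, l0]⟩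
  let Y : ℂ → SL2 := fun t => ⟨!![k, 0; t, k⁻¹], by simp [det_fin_two, k0]⟩
  have tX : trace (X : Matrix (Fin 2) (Fin 2) ℂ) = l + l⁻¹ := by simp [X, trace_fin_two]
  have tY : ∀ t, trace (Y t : Matrix (Fin 2) (Fin 2) ℂ) = k + k⁻¹ := by
    intro t; simp [Y, trace_fin_two]
  have hw : ∃ t, trace ((Y t ^ j * X * Y t * X ^ i : SL2) : Matrix (Fin 2) (Fin 2) ℂ) =
      n + n⁻¹ := by
    have hX := sl2_zpow X l l0 l2 tX i
    have hY := fun t => sl2_zpow (Y t) k k0 k2 (tY t) j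
    set p := cheb l i with hp
    set p' := cheb l (i - 1) with hp'
    set q := cheb k j with hq
    set q' := cheb k (j - 1) with hq'
    have hcomp : ∃ b c : ℂ, (∀ t, trace ((Y t ^ j * X * Y t * X ^ i : SL2) : Matrix (Fin 2) (Fin 2) ℂ) =
        p * q * (t * t) + b * t + c) ∧ (p = 0 → q = 0 → b = p' * q') := by
      refine ⟨p * q * (l * k + l⁻¹ * k⁻¹ + l * k + l⁻¹ * k⁻¹)
        - p * q' * (l + l⁻¹) - q * p' * (k + k⁻¹) + p' * q',
        p * q * ((l * k)^2 + (l⁻¹ * k⁻¹)^2) - p * q' * (l ^ 2 * k + l⁻¹ ^ 2 * k⁻¹)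
          - q * p' * (l * k ^ 2 + l⁻¹ * k⁻¹ ^ 2) + p' * q' * (l * k + l⁻¹ * k⁻¹), ?_, ?_⟩
      · intro t
        rw [Matrix.SpecialLinearGroup.coe_mul, Matrix.SpecialLinearGroup.coe_mul, Matrix.SpecialLinearGroup.coe_mul,
          hX, hY]
        simp [X, Y, trace_fin_two, Matrix.mul_apply, Fin.sum_univ_two]
        have e1 : l * l⁻¹ = 1 := mul_inv_cancel₀ l0
        have e2 : k * k⁻¹ = 1 := mul_inv_cancel₀ k0
        ring_nf
        try simp [l0, k0]
        try ring_nf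
      · intro h1 h2; rw [h1, h2]; ring
    obtain ⟨b, c, h1, h2⟩ := hcomp
    rcases hij with ⟨hi, hj⟩ | ⟨rfl, rfl⟩
    · have pn : p ≠ 0 := fun e => hi ((hl i).1 ((cheb_eq_zero l0 l2 i).1 e))
      have qn : q ≠ 0 := fun e => hj ((hk j).1 ((cheb_eq_zero k0 k2 j).1 e))
      obtain ⟨t, ht⟩ := exists_quadratic_eq_zero (a := p * q) (b := b) (c := c - (n + n⁻¹))
        (mul_ne_zero pn qn) (by
          obtain ⟨s, hs⟩ := IsAlgClosed.exists_pow_nat_eq (discrim (p * q) b (c - (n + n⁻¹)))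
            (n := 2) two_pos
          exact ⟨s, by rw [← hs, pow_two]⟩)
      refine ⟨t, ?_⟩
      rw [h1]; linear_combination ht
    · have p0 : p = 0 := cheb_zero l
      have q0 : q = 0 := cheb_zero k
      have hb : b = 1 := by
        rw [h2 p0 q0, hp', hq', zero_sub, cheb_neg_one l0 l2, cheb_neg_one k0 k2]; ring
      refine ⟨n + n⁻¹ - c, ?_⟩
      rw [h1, p0, hb]; ring
  obtain ⟨t, ht⟩ := hw
  set w := Y t ^ j * X * Y t * X ^ i with hwdef
  have hc : ∀ (z : SL2) (m : ℤ), ((z : SL2 ⧸ Subgroup.center SL2)) ^ m = 1 ↔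
      z ^ m ∈ Subgroup.center SL2 := by
    intro z m
    rw [← QuotientGroup.eq_one_iff]
    rfl
  refine ⟨(X : SL2 ⧸ Subgroup.center SL2), (Y t : SL2 ⧸ Subgroup.center SL2),
    ((w : SL2 ⧸ Subgroup.center SL2))⁻¹, ?_, ?_, ?_, ?_⟩
  · have : (w : SL2 ⧸ Subgroup.center SL2) = (Y t : SL2 ⧸ Subgroup.center SL2) ^ j *
      (X : SL2 ⧸ Subgroup.center SL2) * (Y t : SL2 ⧸ Subgroup.center SL2) *
      (X : SL2 ⧸ Subgroup.center SL2) ^ i := rfl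
    rw [this]; group
  · intro m
    rw [_root_.inv_zpow, inv_eq_one, hc, sl2_order w n n0 n2 ht, hn]
  · intro m
    rw [hc, sl2_order X l l0 l2 tX, hl]
  · intro m
    rw [hc, sl2_order (Y t) k k0 k2 (tY t), hk]

end matrices

/-- Solving `x y xⁱ a yʲ = 1`. -/
theorem solve_R {A B C : Type u} [Group A] [Group B] [Group C] (a : A) (x : B) (y : C) (i j : ℤ)
    (ha : a ≠ 1) (hx : x ≠ 1) (hy : y ≠ 1)
    (hij : (x ^ i ≠ 1 ∧ y ^ j ≠ 1) ∨ (i = 0 ∧ j = 0)) :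
    ∃ (K : Type u) (_ : Group K) (f : A →* K) (g : B →* K) (h : C →* K),
      Function.Injective f ∧ Function.Injective g ∧ Function.Injective h ∧
      g x * h y * g x ^ i * f a * h y ^ j = 1 := by
  obtain ⟨X, Y, Z, hrel, hZ, hX, hY⟩ := exists_psl a x y i j ha hx hy hij
  let e : (SL2 ⧸ Subgroup.center SL2) →* ULift.{u} (SL2 ⧸ Subgroup.center SL2) :=
    MulEquiv.ulift.symm.toMonoidHom
  have he : Function.Injective e := MulEquiv.ulift.symm.injective
  obtain ⟨K₁, _, i₁, f, hi₁, hf, e₁⟩ := glue_zpowers (e Z) a (fun m => by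
    rw [← map_zpow, map_eq_one_iff e he, hZ])
  obtain ⟨K₂, _, i₂, g, hi₂, hg, e₂⟩ := glue_zpowers (i₁ (e X)) x (fun m => by
    rw [← map_zpow, ← map_zpow, map_eq_one_iff i₁ hi₁, map_eq_one_iff e he, hX])
  obtain ⟨K₃, _, i₃, h, hi₃, hh, e₃⟩ := glue_zpowers (i₂ (i₁ (e Y))) y (fun m => by
    rw [← map_zpow, ← map_zpow, ← map_zpow, map_eq_one_iff i₂ hi₂, map_eq_one_iff i₁ hi₁,
      map_eq_one_iff e he, hY])
  refine ⟨K₃, inferInstance, (i₃.comp i₂).comp f, i₃.comp g, h, (hi₃.comp hi₂).comp hf,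
    hi₃.comp hg, hh, ?_⟩
  simp only [MonoidHom.comp_apply]
  rw [← e₁, ← e₂, ← e₃]
  simp only [← map_mul, ← map_zpow, hrel, map_one]


/-- The equation `c₁ a₁ b₁ a₂ c₂ a₃ b₂ a₄ = 1` has a solution in an overgroup. -/
def Good {A B C : Type u} [Group A] [Group B] [Group C] (a₁ a₂ a₃ a₄ : A) (b₁ b₂ : B)
    (c₁ c₂ : C) : Prop :=
  ∃ (K : Type u) (_ : Group K) (f : A →* K) (g : B →* K) (h : C →* K),
    Function.Injective f ∧ Function.Injective g ∧ Function.Injective h ∧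
    h c₁ * f a₁ * g b₁ * f a₂ * h c₂ * f a₃ * g b₂ * f a₄ = 1

section good

variable {A B C : Type u} [Group A] [Group B] [Group C]

theorem conj_one {K : Type*} [Group K] {x y : K} (h : x * y = 1) : y * x = 1 :=
  mul_eq_one_comm.mp h

/-- Rotation by two letters, exchanging the roles of `B` and `C`. -/
theorem Good.rot {a₁ a₂ a₃ a₄ : A} {b₁ b₂ : B} {c₁ c₂ : C}
    (H : Good a₂ a₃ a₄ a₁ c₂ c₁ b₁ b₂) : Good a₁ a₂ a₃ a₄ b₁ b₂ c₁ c₂ := by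
  obtain ⟨K, _, f, g, h, hf, hg, hh, e⟩ := H
  refine ⟨K, inferInstance, f, h, g, hf, hh, hg, ?_⟩
  have : (h b₁ * f a₂ * g c₂ * f a₃ * h b₂ * f a₄) * (g c₁ * f a₁) = 1 := by
    rw [← e]; group
  rw [← conj_one this]; group

theorem Good.rot2 {a₁ a₂ a₃ a₄ : A} {b₁ b₂ : B} {c₁ c₂ : C}
    (H : Good a₃ a₄ a₁ a₂ b₂ b₁ c₂ c₁) : Good a₁ a₂ a₃ a₄ b₁ b₂ c₁ c₂ :=
  Good.rot (Good.rot H)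

/-- The free case, seen over `B`. -/
theorem view1 (a₁ a₂ a₃ a₄ : A) (b₁ b₂ : B) (c₁ c₂ : C)
    (hb₁ : b₁ ≠ 1) (hb₂ : b₂ ≠ 1) (hb : b₁ * b₂ ≠ 1)
    (hc₁ : c₁ ≠ 1) (hc₂ : c₂ ≠ 1) (hc : c₁ * c₂ ≠ 1)
    (h14 : a₁ * a₄ ≠ 1) (h23 : a₂ * a₃ ≠ 1)
    (hh : (a₃ * a₄ ≠ 1 ∧ a₁ ≠ a₃ ∧ a₂ ≠ a₄) ∨ (a₁ * a₂ ≠ 1 ∧ a₁ ≠ a₃ ∧ a₂ ≠ a₄) ∨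
      (a₁ * a₂ ≠ 1 ∧ a₃ * a₄ ≠ 1 ∧ a₂ ≠ a₄ ∧ c₁ ≠ c₂) ∨
      (a₁ * a₂ ≠ 1 ∧ a₃ * a₄ ≠ 1 ∧ a₁ ≠ a₃ ∧ c₁ ≠ c₂)) :
    Good a₁ a₂ a₃ a₄ b₁ b₂ c₁ c₂ := by
  obtain ⟨H, _, f, h, hf, hh', F, -, F3⟩ := exists_fp_pp A C
  have st : a₄⁻¹ ≠ a₁ := fun e => h14 (by rw [← e, inv_mul_cancel])
  have uv : a₂⁻¹ ≠ a₃ := fun e => h23 (by rw [← e, mul_inv_cancel])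
  have htu : a₁ * a₂ ≠ 1 → a₁ ≠ a₂⁻¹ := fun h e => h (by rw [e, inv_mul_cancel])
  have hsv : a₃ * a₄ ≠ 1 → a₄⁻¹ ≠ a₃ := fun h e => h (by rw [← e, inv_mul_cancel])
  have hsu : a₂ ≠ a₄ → a₄⁻¹ ≠ a₂⁻¹ := fun h e => h (inv_injective e).symm
  have i₁ := inv_ne_one.mpr hc₁
  have i₂ := inv_ne_one.mpr hc₂
  have cc : c₁ ≠ c₂⁻¹ := fun e => hc (by rw [e, inv_mul_cancel])
  have cc' : c₁⁻¹ ≠ c₂ := fun e => hc (by rw [← e, mul_inv_cancel])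
  have eX : (f a₁⁻¹ * h c₁⁻¹ * f a₄⁻¹)⁻¹ = f a₄ * h c₁ * f a₁ := by simp [mul_assoc]
  have eY : (f a₃⁻¹ * h c₂⁻¹ * f a₂⁻¹)⁻¹ = f a₂ * h c₂ * f a₃ := by simp [mul_assoc]
  have pp : PP (f a₂ * h c₂ * f a₃) (f a₄ * h c₁ * f a₁) := by
    rcases hh with ⟨h34, d13, d24⟩ | ⟨h12, d13, d24⟩ | ⟨h12, h34, d24, hcc⟩ | ⟨h12, h34, d13, hcc⟩
    · -- possibly `t = u`
      have := F a₄⁻¹ a₁ a₃ a₂⁻¹ c₁ c₂⁻¹ hc₁ i₂ st (hsv h34) (hsu d24) d13 uv.symm (Or.inr cc)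
      have := this.inv_left
      rwa [eY, inv_inv] at this
    · -- possibly `s = v`
      have := F a₁ a₄⁻¹ a₂⁻¹ a₃ c₁⁻¹ c₂ i₁ hc₂ st.symm (htu h12) d13 (hsu d24) uv (Or.inr cc')
      have := this.inv_right
      rwa [eX, inv_inv] at this
    · -- possibly `t = v`
      have := F a₄⁻¹ a₁ a₂⁻¹ a₃ c₁ c₂ hc₁ hc₂ st (hsu d24) (hsv h34) (htu h12) uv (Or.inr hcc)
      rwa [inv_inv, inv_inv] at this
    · -- possibly `s = u`
      have := F a₁ a₄⁻¹ a₃ a₂⁻¹ c₁⁻¹ c₂⁻¹ i₁ i₂ st.symm d13 (htu h12) (hsv h34) uv.symm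
        (Or.inr (fun e => hcc (inv_injective e)))
      have := this.inv_left.inv_right
      rwa [eX, eY] at this
  have hQ : f a₄ * h c₁ * f a₁ ≠ 1 := by
    intro e
    have h1 : h c₁ = f (a₄⁻¹ * a₁⁻¹) := by
      rw [map_mul, map_inv, map_inv]
      calc h c₁ = (f a₄)⁻¹ * (f a₄ * h c₁ * f a₁) * (f a₁)⁻¹ := by group
        _ = _ := by rw [e]; group
    exact F3 _ _ hc₁ h1
  obtain ⟨K, _, i, j, hi, hj, e⟩ := solve_pp pp hQ b₁ b₂ hb₁ hb₂ hb
  refine ⟨K, inferInstance, i.comp f, j, i.comp h, hi.comp hf, hj, hi.comp hh', ?_⟩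
  have e' : (j b₁ * i (f a₂) * i (h c₂) * i (f a₃) * j b₂ * i (f a₄)) * (i (h c₁) * i (f a₁))
      = 1 := by
    rw [← e]; simp only [map_mul]; group
  rw [← conj_one e']; simp only [MonoidHom.comp_apply]; group

theorem conj_inj {B K : Type*} [Group B] [Group K] (k : K) (g : B →* K)
    (hg : Function.Injective g) :
    Function.Injective ((MulAut.conj k).toMonoidHom.comp g) :=
  (MulAut.conj k).injective.comp hg

/-- It is enough to solve the equation after conjugating `B` by `a₁`. -/
theorem Good.of_conj {a₁ a₂ a₃ a₄ : A} {b₁ b₂ : B} {c₁ c₂ : C} {K : Type u} [Group K]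
    (f : A →* K) (g : B →* K) (h : C →* K)
    (hf : Function.Injective f) (hg : Function.Injective g) (hh : Function.Injective h)
    (e : h c₁ * g b₁ * f (a₁ * a₂) * h c₂ * f (a₃ * a₁⁻¹) * g b₂ * f (a₁ * a₄) = 1) :
    Good a₁ a₂ a₃ a₄ b₁ b₂ c₁ c₂ := by
  refine ⟨K, inferInstance, f, (MulAut.conj (f a₁)⁻¹).toMonoidHom.comp g, h, hf,
    conj_inj _ g hg, hh, ?_⟩
  rw [← e]
  have hcj : ∀ b, ((MulAut.conj (f a₁)⁻¹).toMonoidHom.comp g) b = (f a₁)⁻¹ * g b * f a₁ := by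
    intro b
    change (f a₁)⁻¹ * g b * (f a₁)⁻¹⁻¹ = _
    rw [inv_inv]
  rw [hcj, hcj, map_mul, map_mul, map_mul, map_inv]
  group

/-- A square-type equation. -/
theorem solve_T (x : C) (y : B) (z₁ z₂ : A) (hx : x ≠ 1) (hy : y ≠ 1) :
    ∃ (K : Type u) (_ : Group K) (f : A →* K) (g : B →* K) (h : C →* K),
      Function.Injective f ∧ Function.Injective g ∧ Function.Injective h ∧
      h x * g y * f z₁ * h x * g y * f z₂ = 1 := by
  let P := Equiv.Perm (A × Bool)
  let m : A →* P :=
    { toFun := fun a => (Equiv.mulLeft a).prodCongr (Equiv.refl Bool)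
      map_one' := by ext p <;> simp
      map_mul' := fun a b => Equiv.ext fun p => by
        change ((a * b) * p.1, p.2) = (a * (b * p.1), p.2)
        rw [mul_assoc] }
  have hm : ∀ a p, m a p = (a * p.1, p.2) := fun a p => rfl
  have minj : Function.Injective m := by
    intro a b e
    have := congrArg (fun q : P => (q (1, true)).1) e
    simpa [hm] using this
  let a := z₂⁻¹ * z₁
  let W : P :=
    { toFun := fun p => if p.2 then (a * p.1, false) else (p.1, true)
      invFun := fun p => if p.2 then (p.1, false) else (a⁻¹ * p.1, true)
      left_inv := by rintro ⟨p, (_ | _)⟩ <;> simp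
      right_inv := by rintro ⟨p, (_ | _)⟩ <;> simp }
  have hW : ∀ p, W p = if p.2 then (a * p.1, false) else (p.1, true) := fun p => rfl
  have hWW : W * W = m a := by
    apply Equiv.ext
    intro p
    change W (W p) = m a p
    obtain ⟨p, (_ | _)⟩ := p <;> simp [hm, hW]
  have hk : m z₁ * W⁻¹ ≠ 1 := by
    intro e
    have e' : m z₁ = W := by rw [← mul_inv_eq_one]; exact e
    have := congrArg (fun q : P => (q (1, true)).2) e'
    simp [hm, hW] at this
  obtain ⟨K, _, f, g, h, hf, hg, hh, e⟩ := solve_R (m z₁ * W⁻¹) x y 0 0 hk hx hy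
    (Or.inr ⟨rfl, rfl⟩)
  refine ⟨K, inferInstance, f.comp m, h, g, hf.comp minj, hh, hg, ?_⟩
  simp only [zpow_zero, mul_one] at e
  have e1 : g x * h y = f W * (f (m z₁))⁻¹ := by
    rw [map_mul, map_inv] at e
    calc g x * h y = (g x * h y * (f (m z₁) * (f W)⁻¹)) * (f W * (f (m z₁))⁻¹) := by group
      _ = _ := by rw [e, one_mul]
  have e2 : f W * f W = (f (m z₂))⁻¹ * f (m z₁) := by
    rw [← map_mul, hWW]; simp [a]
  simp only [MonoidHom.comp_apply]
  calc g x * h y * f (m z₁) * g x * h y * f (m z₂)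
      = (g x * h y) * f (m z₁) * (g x * h y) * f (m z₂) := by group
    _ = (f W * f W) * (f (m z₁))⁻¹ * f (m z₂) := by rw [e1]; group
    _ = 1 := by rw [e2]; group

/-- Three coincidences. -/
theorem triple (a₁ a₂ a₃ a₄ : A) (b₁ b₂ : B) (c₁ c₂ : C)
    (hb₁ : b₁ ≠ 1) (hb₂ : b₂ ≠ 1) (hb : b₁ * b₂ ≠ 1)
    (hc₁ : c₁ ≠ 1) (hc₂ : c₂ ≠ 1) (hc : c₁ * c₂ ≠ 1)
    (ha : a₁ * a₂ * a₃ * a₄ ≠ 1)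
    (h13 : a₁ = a₃) (h14 : a₁ * a₄ = 1) : Good a₁ a₂ a₃ a₄ b₁ b₂ c₁ c₂ := by
  subst h13
  have ha' : a₁ * a₂ ≠ 1 := by
    rwa [mul_assoc _ a₁ a₄, h14, mul_one] at ha
  generalize hx : a₁ * a₂ = a at ha'
  suffices H : ∃ (K : Type u) (_ : Group K) (f : A →* K) (g : B →* K) (h : C →* K),
      Function.Injective f ∧ Function.Injective g ∧ Function.Injective h ∧
      h c₁ * g b₁ * f a * h c₂ * g b₂ = 1 by
    obtain ⟨K, _, f, g, h, hf, hg, hh, e⟩ := H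
    refine Good.of_conj f g h hf hg hh ?_
    rw [h14, mul_inv_cancel, hx, map_one, mul_one, mul_one, e]
  by_cases h1 : ∀ j : ℤ, c₁ ^ j ≠ c₂
  · obtain ⟨H, _, f, h, hf, hh, -, F2, F3⟩ := exists_fp_pp A C
    have pp := F2 1 a⁻¹ c₁ c₂⁻¹ hc₁ (inv_ne_one.mpr hc₂) (inv_ne_one.mpr ha').symm
      (inv_ne_one.mpr ha') (Or.inr fun j e => h1 (-j) (by rw [zpow_neg, e, inv_inv]))
    obtain ⟨K, _, i, j, hi, hj, e⟩ := solve_pp pp.inv_left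
      (by rw [Ne, map_eq_one_iff h hh]; exact hc₁) b₁ b₂ hb₁ hb₂ hb
    refine ⟨K, inferInstance, i.comp f, j, i.comp h, hi.comp hf, hj, hi.comp hh, ?_⟩
    have := conj_one e
    rw [← this]
    simp only [MonoidHom.comp_apply, map_mul, map_inv, map_one, mul_inv_rev, inv_inv, inv_one]
    group
  by_cases h2 : ∀ j : ℤ, b₂ ^ j ≠ b₁
  · obtain ⟨H, _, f, g, hf, hg, -, F2, F3⟩ := exists_fp_pp A B
    have pp := F2 1 a b₂ b₁ hb₂ hb₁ ha'.symm ha' (Or.inr h2)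
    obtain ⟨K, _, i, j, hi, hj, e⟩ := solve_pp pp
      (by rw [Ne, map_eq_one_iff g hg]; exact hb₂) c₁ c₂ hc₁ hc₂ hc
    refine ⟨K, inferInstance, i.comp f, i.comp g, j, hi.comp hf, hi.comp hg, hj, ?_⟩
    rw [← e]
    simp only [MonoidHom.comp_apply, map_mul, map_one, inv_one]
    group
  push Not at h1 h2
  obtain ⟨j, rfl⟩ := h1
  obtain ⟨i, rfl⟩ := h2
  obtain ⟨K, _, f, g, h, hf, hg, hh, e⟩ := solve_R a b₂ c₁ i j ha' hb₂ hc₁ (Or.inl ⟨hb₁, hc₂⟩)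
  refine ⟨K, inferInstance, f, g, h, hf, hg, hh, ?_⟩
  have e' : g b₂ * (h c₁ * g b₂ ^ i * f a * h c₁ ^ j) = 1 := by rw [← e]; group
  rw [← conj_one e', map_zpow, map_zpow]

/-- The doubly periodic case with distinct letters. -/
theorem view3 (a₁ a₂ a₃ a₄ : A) (b₁ b₂ : B) (c₁ c₂ : C)
    (hb₁ : b₁ ≠ 1) (hb₂ : b₂ ≠ 1)
    (hc₁ : c₁ ≠ 1) (hc₂ : c₂ ≠ 1)
    (ha : a₁ * a₂ * a₃ * a₄ ≠ 1)
    (h13 : a₁ = a₃) (h24 : a₂ = a₄) (hcc : c₁ ≠ c₂) (hbb : b₁ ≠ b₂) :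
    Good a₁ a₂ a₃ a₄ b₁ b₂ c₁ c₂ := by
  subst h13 h24
  have ha2 : (a₁ * a₂) * (a₁ * a₂) ≠ 1 := by rwa [← mul_assoc]
  have ha1 : a₁ * a₂ ≠ 1 := fun e => ha2 (by rw [e, mul_one])
  obtain ⟨H, _, g, h, hg, hh, F, -, F3⟩ := exists_fp_pp B C
  have pp := F b₁ 1 b₂ 1 c₁⁻¹ c₂⁻¹ (inv_ne_one.mpr hc₁) (inv_ne_one.mpr hc₂) hb₁ hbb hb₁ hb₂.symm
    hb₂ (Or.inr fun e => hcc (inv_injective e))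
  obtain ⟨K, _, i, j, hi, hj, e⟩ := solve_pp pp.inv_left.inv_right (by
    rw [inv_ne_one, map_one, mul_one, map_inv, map_inv]
    intro e
    refine F3 b₁⁻¹ c₁ hc₁ ?_
    rw [map_inv]
    calc h c₁ = ((g b₁)⁻¹ * (h c₁)⁻¹)⁻¹ * (g b₁)⁻¹ := by group
      _ = _ := by rw [e]; group) _ _ ha1 ha1 ha2
  refine Good.of_conj j (i.comp g) (i.comp h) hj (hi.comp hg) (hi.comp hh) ?_
  rw [← conj_one e, mul_inv_cancel]
  simp only [MonoidHom.comp_apply, map_mul, map_inv, map_one, mul_inv_rev, inv_inv, inv_one]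
  group

/-- Everything is periodic except possibly `a₂, a₄`. -/
theorem caseT (a₁ a₂ a₃ a₄ : A) (b₁ b₂ : B) (c₁ c₂ : C) (hb₁ : b₁ ≠ 1) (hc₁ : c₁ ≠ 1)
    (h13 : a₁ = a₃) (hcc : c₁ = c₂) (hbb : b₁ = b₂) : Good a₁ a₂ a₃ a₄ b₁ b₂ c₁ c₂ := by
  subst h13 hcc hbb
  obtain ⟨K, _, f, g, h, hf, hg, hh, e⟩ := solve_T c₁ b₁ (a₁ * a₂) (a₁ * a₄) hc₁ hb₁
  refine Good.of_conj f g h hf hg hh ?_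
  rw [mul_inv_cancel, map_one, mul_one, e]

/-- Everything is periodic except possibly `c₁, c₂`. -/
theorem caseM (a₁ a₂ a₃ a₄ : A) (b₁ b₂ : B) (c₁ c₂ : C) (hb₁ : b₁ ≠ 1)
    (ha : a₁ * a₂ * a₃ * a₄ ≠ 1)
    (h13 : a₁ = a₃) (h24 : a₂ = a₄) (hbb : b₁ = b₂) : Good a₁ a₂ a₃ a₄ b₁ b₂ c₁ c₂ := by
  subst h13 h24 hbb
  have ha1 : a₁ * a₂ ≠ 1 := fun e => ha (by rw [mul_assoc _ a₁ a₂, e, mul_one])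
  obtain ⟨K, _, h, f, g, hh, hf, hg, e⟩ := solve_T b₁ (a₁ * a₂) c₂ c₁ hb₁ ha1
  refine Good.of_conj f g h hf hg hh ?_
  rw [mul_inv_cancel, map_one, mul_one]
  rw [← conj_one e]
  group

/-- The case `a₁ = a₃`. -/
theorem case13 (a₁ a₂ a₃ a₄ : A) (b₁ b₂ : B) (c₁ c₂ : C)
    (hb₁ : b₁ ≠ 1) (hb₂ : b₂ ≠ 1) (hb : b₁ * b₂ ≠ 1)
    (hc₁ : c₁ ≠ 1) (hc₂ : c₂ ≠ 1) (hc : c₁ * c₂ ≠ 1)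
    (ha : a₁ * a₂ * a₃ * a₄ ≠ 1) (h13 : a₁ = a₃) : Good a₁ a₂ a₃ a₄ b₁ b₂ c₁ c₂ := by
  have hb' : b₂ * b₁ ≠ 1 := fun e => hb (conj_one e)
  have hc' : c₂ * c₁ ≠ 1 := fun e => hc (conj_one e)
  have ha' : a₂ * a₃ * a₄ * a₁ ≠ 1 := fun e => ha (by
    rw [← conj_one e]; group)
  have ha'' : a₃ * a₄ * a₁ * a₂ ≠ 1 := fun e => ha' (by
    have e2 := conj_one (x := a₃ * a₄) (y := a₁ * a₂) (by rw [← e]; group)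
    have e3 := conj_one (x := a₁) (y := a₂ * (a₃ * a₄)) (by rw [← e2]; group)
    rw [← e3]; group)
  by_cases h24 : a₂ = a₄
  · by_cases hbb : b₁ = b₂
    · exact caseM _ _ _ _ _ _ _ _ hb₁ ha h13 h24 hbb
    by_cases hcc : c₁ = c₂
    · exact Good.rot (caseM _ _ _ _ _ _ _ _ hc₂ ha' h24 h13.symm hcc.symm)
    · exact view3 _ _ _ _ _ _ _ _ hb₁ hb₂ hc₁ hc₂ ha h13 h24 hcc hbb
  by_cases h14 : a₁ * a₄ = 1
  · exact triple _ _ _ _ _ _ _ _ hb₁ hb₂ hb hc₁ hc₂ hc ha h13 h14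
  by_cases h12 : a₁ * a₂ = 1
  · exact Good.rot2 (triple _ _ _ _ _ _ _ _ hb₂ hb₁ hb' hc₂ hc₁ hc' ha'' h13.symm
      (by rw [← h13]; exact h12))
  have h23 : a₂ * a₃ ≠ 1 := fun e => h12 (by rw [h13]; exact conj_one e)
  have h34 : a₃ * a₄ ≠ 1 := by rwa [← h13]
  by_cases hcc : c₁ = c₂
  · by_cases hbb : b₁ = b₂
    · exact caseT _ _ _ _ _ _ _ _ hb₁ hc₁ h13 hcc hbb
    · refine Good.rot (view1 _ _ _ _ _ _ _ _ hc₂ hc₁ hc' hb₁ hb₂ hb (fun e => h12 (conj_one e)) h34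
        (Or.inr (Or.inr (Or.inr ⟨h23, fun e => h14 (conj_one e), h24, hbb⟩))))
  · exact view1 _ _ _ _ _ _ _ _ hb₁ hb₂ hb hc₁ hc₂ hc h14 h23
      (Or.inr (Or.inr (Or.inl ⟨h12, h34, h24, hcc⟩)))

theorem good_main (a₁ a₂ a₃ a₄ : A) (b₁ b₂ : B) (c₁ c₂ : C)
    (hb₁ : b₁ ≠ 1) (hb₂ : b₂ ≠ 1) (hb : b₁ * b₂ ≠ 1)
    (hc₁ : c₁ ≠ 1) (hc₂ : c₂ ≠ 1) (hc : c₁ * c₂ ≠ 1)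
    (ha : a₁ * a₂ * a₃ * a₄ ≠ 1) : Good a₁ a₂ a₃ a₄ b₁ b₂ c₁ c₂ := by
  have hc' : c₂ * c₁ ≠ 1 := fun e => hc (conj_one e)
  have ha' : a₂ * a₃ * a₄ * a₁ ≠ 1 := fun e => ha (by
    rw [← conj_one e]; group)
  by_cases h13 : a₁ = a₃
  · exact case13 _ _ _ _ _ _ _ _ hb₁ hb₂ hb hc₁ hc₂ hc ha h13
  by_cases h24 : a₂ = a₄
  · exact Good.rot (case13 _ _ _ _ _ _ _ _ hc₂ hc₁ hc' hb₁ hb₂ hb ha' h24)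
  have i1 : ∀ {x y z : A}, x * y = 1 → x * z = 1 → y = z := fun h h' =>
    mul_left_cancel (h.trans h'.symm)
  by_cases h12 : a₁ * a₂ = 1
  · have h14 : a₁ * a₄ ≠ 1 := fun e => h24 (i1 h12 e)
    have h23 : a₂ * a₃ ≠ 1 := fun e => h13 (i1 (conj_one h12) e)
    have h34 : a₃ * a₄ ≠ 1 := fun e => ha (by rw [h12, one_mul, e])
    exact view1 _ _ _ _ _ _ _ _ hb₁ hb₂ hb hc₁ hc₂ hc h14 h23 (Or.inl ⟨h34, h13, h24⟩)
  by_cases h34 : a₃ * a₄ = 1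
  · have h14 : a₁ * a₄ ≠ 1 := fun e => h13 (i1 (conj_one e) (conj_one h34))
    have h23 : a₂ * a₃ ≠ 1 := fun e => h24 (i1 (conj_one e) h34)
    exact view1 _ _ _ _ _ _ _ _ hb₁ hb₂ hb hc₁ hc₂ hc h14 h23
      (Or.inr (Or.inl ⟨h12, h13, h24⟩))
  refine Good.rot (view1 _ _ _ _ _ _ _ _ hc₂ hc₁ hc' hb₁ hb₂ hb (fun e => h12 (conj_one e)) h34 ?_)
  by_cases h14 : a₄ * a₁ = 1
  · refine Or.inr (Or.inl ⟨fun e => ha' ?_, h24, Ne.symm h13⟩)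
    rw [e, one_mul, h14]
  · exact Or.inl ⟨h14, h24, Ne.symm h13⟩

end good

end P58

/-- **Proposition 5.8 (Chinyere–Howie).** Standing assumptions as in Lemma 5.3.  If
`U = αβα₁` and `V = α₂β₁α₃`, with `α, α₁, α₂, α₃` nontrivial in `A` and
`β, β₁` nontrivial in `B`, then `G` is nontrivial. -/
theorem prop_5_8
    {G : Fin 3 → Type*} [∀ i, Group (G i)] [∀ i, Nontrivial (G i)]
    (c₁ c₂ : G 2) (hc₁ : c₁ ≠ 1) (hc₂ : c₂ ≠ 1) (hc₁c₂ : c₁ * c₂ ≠ 1)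
    (U V : Monoid.CoprodI (subFamily G))
    (hlen : CoprodI.length U + CoprodI.length V ≤ 6)
    (hUVA : U * V ∉ Subgroup.normalClosure
      (Set.range (Monoid.CoprodI.of : subFamily G 0 →* Monoid.CoprodI (subFamily G))))
    (hUVB : U * V ∉ Subgroup.normalClosure
      (Set.range (Monoid.CoprodI.of : subFamily G 1 →* Monoid.CoprodI (subFamily G))))
    (α α₁ α₂ α₃ : subFamily G 0) (β β₁ : subFamily G 1)
    (hα : α ≠ 1) (hα₁ : α₁ ≠ 1) (hα₂ : α₂ ≠ 1) (hα₃ : α₃ ≠ 1)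
    (hβ : β ≠ 1) (hβ₁ : β₁ ≠ 1)
    (hU : U = (Monoid.CoprodI.of : subFamily G 0 →* Monoid.CoprodI (subFamily G)) α * (Monoid.CoprodI.of : subFamily G 1 →* Monoid.CoprodI (subFamily G)) β * (Monoid.CoprodI.of : subFamily G 0 →* Monoid.CoprodI (subFamily G)) α₁)
    (hV : V = (Monoid.CoprodI.of : subFamily G 0 →* Monoid.CoprodI (subFamily G)) α₂ * (Monoid.CoprodI.of : subFamily G 1 →* Monoid.CoprodI (subFamily G)) β₁ * (Monoid.CoprodI.of : subFamily G 0 →* Monoid.CoprodI (subFamily G)) α₃)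
    :
    Nontrivial (Monoid.CoprodI G ⧸ Subgroup.normalClosure
      {(Monoid.CoprodI.of : G 2 →* Monoid.CoprodI G) c₁ * CoprodI.embed G U *
        (Monoid.CoprodI.of : G 2 →* Monoid.CoprodI G) c₂ * CoprodI.embed G V}) := by
  
  have hb : β * β₁ ≠ 1 := by
    intro hb
    apply hUVA
    set N := Subgroup.normalClosure
      (Set.range (Monoid.CoprodI.of : subFamily G 0 →* Monoid.CoprodI (subFamily G))) with hN
    have mem : ∀ a : subFamily G 0, Monoid.CoprodI.of a ∈ N := fun a =>
      Subgroup.subset_normalClosure ⟨a, rfl⟩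
    have e : β₁ = β⁻¹ := eq_inv_of_mul_eq_one_right hb
    have e2 : U * V = Monoid.CoprodI.of α *
        (Monoid.CoprodI.of β * Monoid.CoprodI.of (α₁ * α₂) * (Monoid.CoprodI.of β)⁻¹) *
        Monoid.CoprodI.of α₃ := by
      rw [hU, hV, e, map_inv, map_mul]
      group
    rw [e2]
    exact N.mul_mem (N.mul_mem (mem _)
      (Subgroup.Normal.conj_mem inferInstance _ (mem _) _)) (mem _)
  have ha : α * α₁ * α₂ * α₃ ≠ 1 := by
    intro ha
    apply hUVB
    set N := Subgroup.normalClosure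
      (Set.range (Monoid.CoprodI.of : subFamily G 1 →* Monoid.CoprodI (subFamily G))) with hN
    have mem : ∀ b : subFamily G 1, Monoid.CoprodI.of b ∈ N := fun a =>
      Subgroup.subset_normalClosure ⟨a, rfl⟩
    have e : α₃ = (α * α₁ * α₂)⁻¹ := eq_inv_of_mul_eq_one_right ha
    have e2 : U * V = (Monoid.CoprodI.of α * Monoid.CoprodI.of β * (Monoid.CoprodI.of α)⁻¹) *
        (Monoid.CoprodI.of (α * α₁ * α₂) * Monoid.CoprodI.of β₁ *
          (Monoid.CoprodI.of (α * α₁ * α₂))⁻¹) := by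
      rw [hU, hV, e, map_inv, map_mul, map_mul]
      group
    rw [e2]
    exact N.mul_mem (Subgroup.Normal.conj_mem inferInstance _ (mem _) _)
      (Subgroup.Normal.conj_mem inferInstance _ (mem _) _)
  obtain ⟨K, _, f, g, h, -, -, hh, e⟩ := P58.good_main (A := G 0) (B := G 1) (C := G 2)
    α α₁ α₂ α₃ β β₁ c₁ c₂ hβ hβ₁ hb hc₁ hc₂ hc₁c₂ ha
  let k : ∀ i, G i →* K := fun i => match i with
    | 0 => f
    | 1 => g
    | 2 => h
  let φ : Monoid.CoprodI G →* K := Monoid.CoprodI.lift k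
  have k0 : ∀ a : subFamily G 0, φ (CoprodI.embed G (Monoid.CoprodI.of a)) = f a := by
    intro a
    have e1 : CoprodI.embed G (Monoid.CoprodI.of a) =
        (Monoid.CoprodI.of : G 0 →* Monoid.CoprodI G) a :=
      Monoid.CoprodI.lift_of (M := subFamily G) (N := Monoid.CoprodI G)
        (fun i => (Monoid.CoprodI.of : G i.castSucc →* Monoid.CoprodI G)) (i := 0) a
    rw [e1]
    exact Monoid.CoprodI.lift_of k (i := 0) a
  have k1 : ∀ a : subFamily G 1, φ (CoprodI.embed G (Monoid.CoprodI.of a)) = g a := by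
    intro a
    have e1 : CoprodI.embed G (Monoid.CoprodI.of a) =
        (Monoid.CoprodI.of : G 1 →* Monoid.CoprodI G) a :=
      Monoid.CoprodI.lift_of (M := subFamily G) (N := Monoid.CoprodI G)
        (fun i => (Monoid.CoprodI.of : G i.castSucc →* Monoid.CoprodI G)) (i := 1) a
    rw [e1]
    exact Monoid.CoprodI.lift_of k (i := 1) a
  have k2 : ∀ a : G 2, φ (Monoid.CoprodI.of a) = h a := fun a =>
    Monoid.CoprodI.lift_of k (i := 2) a
  have hker : Subgroup.normalClosure
      {(Monoid.CoprodI.of : G 2 →* Monoid.CoprodI G) c₁ * CoprodI.embed G U *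
        (Monoid.CoprodI.of : G 2 →* Monoid.CoprodI G) c₂ * CoprodI.embed G V} ≤ φ.ker := by
    apply Subgroup.normalClosure_le_normal
    rw [Set.singleton_subset_iff]
    change φ _ = 1
    rw [hU, hV]
    simp only [map_mul, k0, k1, k2]
    rw [← e]
    group
  refine ⟨⟨(QuotientGroup.mk (Monoid.CoprodI.of c₁)), 1, fun hq => hc₁ ?_⟩⟩
  rw [QuotientGroup.eq_one_iff] at hq
  have : φ (Monoid.CoprodI.of c₁) = 1 := hker hq
  rw [k2] at this
  exact hh (this.trans (map_one h).symm)
end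

section
/- Under the setup below, suppose in addition that β⁻¹β₂ has finite order n > 1 and that the subgroup of A*B generated by U and β⁻¹β₂ is the internal free product of the infinite cyclic subgroup ⟨U⟩ and the finite cyclic subgroup ⟨β⁻¹β₂⟩ (so it is isomorphic to ℤ * ℤ/n; this is the condition that the pair {U, β⁻¹β₂} is Nielsen reduced). Then each of A*B and C embeds in G via the natural map, i.e., the natural maps A*B → G and C → G are injective. -/
open Monoid

universe u

/-- The set on which we play ping-pong. -/
abbrev PPSet (C : Type u) : Type u := C × Fin 3 × List (C × Fin 3)

theorem pp_equiv {C : Type u} (p q : PPSet C → Prop) (c c' : C) (i i' : Fin 3)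
    (hp : ∀ l, p (c, i, l)) (hq : ∀ l, q (c', i', l)) :
    Nonempty ({x // p x} ≃ {x // q x}) := by
  refine Function.Embedding.antisymm
    ⟨fun x => ⟨(c', i', (x.1.1, x.1.2.1) :: x.1.2.2), hq _⟩, ?_⟩
    ⟨fun x => ⟨(c, i, (x.1.1, x.1.2.1) :: x.1.2.2), hp _⟩, ?_⟩
  · rintro ⟨⟨a, b, l⟩, h⟩ ⟨⟨a', b', l'⟩, h'⟩ hh
    simp at hh ⊢
    tauto
  · rintro ⟨⟨a, b, l⟩, h⟩ ⟨⟨a', b', l'⟩, h'⟩ hh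
    simp at hh ⊢
    tauto

theorem pp_perm (C : Type u) [Group C] : ∃ a : Equiv.Perm (PPSet C),
    (∀ x, ¬ (x.1 = 1 ∧ x.2.1 = 1) → ((a x).1 = 1 ∧ (a x).2.1 = 0)) ∧
    (∀ x, ¬ (x.1 = 1 ∧ x.2.1 = 0) → ((a⁻¹ x).1 = 1 ∧ (a⁻¹ x).2.1 = 1)) := by
  classical
  obtain ⟨e₁⟩ := pp_equiv (C := C) (fun x => ¬ (x.1 = 1 ∧ x.2.1 = 1)) (fun x => x.1 = 1 ∧ x.2.1 = 0)
    1 1 0 0 (by simp) (by simp)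
  obtain ⟨e₂⟩ := pp_equiv (C := C) (fun x => ¬ ¬ (x.1 = 1 ∧ x.2.1 = 1))
    (fun x => ¬ (x.1 = 1 ∧ x.2.1 = 0)) 1 1 1 1 (by simp) (by simp)
  have h1 : ∀ x, ¬ (x.1 = 1 ∧ x.2.1 = 1) →
      ((Equiv.subtypeCongr e₁ e₂ x).1 = 1 ∧ (Equiv.subtypeCongr e₁ e₂ x).2.1 = 0) := by
    intro x hx
    have : Equiv.subtypeCongr e₁ e₂ x = e₁ ⟨x, hx⟩ := by
      simp [Equiv.subtypeCongr, Equiv.sumCompl_symm_apply_of_pos, hx]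
    rw [this]
    exact (e₁ ⟨x, hx⟩).2
  refine ⟨Equiv.subtypeCongr e₁ e₂, h1, ?_⟩
  intro x hx
  by_contra hcon
  have := h1 _ hcon
  rw [show (Equiv.subtypeCongr e₁ e₂) ((Equiv.subtypeCongr e₁ e₂)⁻¹ x) = x from
    Equiv.apply_symm_apply _ _] at this
  exact hx this

/-- left translation on the ping-pong set -/
def ppAct (C : Type u) [Group C] : C →* Equiv.Perm (PPSet C) where
  toFun c := ⟨fun x => (c * x.1, x.2), fun x => (c⁻¹ * x.1, x.2), fun x => by simp, fun x => by simp⟩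
  map_one' := by ext x <;> simp
  map_mul' a b := by ext x <;> simp [mul_assoc]

theorem ppAct_apply {C : Type u} [Group C] (c : C) (x : PPSet C) :
    ppAct C c x = (c * x.1, x.2) := rfl

/-- ping-pong regions -/
def ppReg {C : Type u} [Group C] (f e : C) : Bool × Bool → PPSet C → Prop
  | (false, true), x => x.1 = 1 ∧ x.2.1 = 0
  | (false, false), x => x.1 = 1 ∧ x.2.1 = 1
  | (true, true), x => x.1 = f ∧ x.2.1 = 0
  | (true, false), x => x.1 = e⁻¹ ∧ x.2.1 = 1

theorem ppReg_disj {C : Type u} [Group C] {f e : C} (hf : f ≠ 1) (he : e ≠ 1)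
    (p q : Bool × Bool) (x : PPSet C) (hp : ppReg f e p x) (hq : ppReg f e q x) : p = q := by
  have he' : e⁻¹ ≠ 1 := by simpa using he
  rcases p with ⟨_ | _, _ | _⟩ <;> rcases q with ⟨_ | _, _ | _⟩ <;>
    simp only [ppReg] at hp hq <;> first | rfl | (exfalso; simp_all)

/-- two element family of generators -/
def ppGen {S : Type*} (a z : S) : Bool → S := fun b => bif b then z else a

theorem exists_pp (C : Type u) [Group C] : ∃ (S : Type u) (_ : Group S) (i : C →* S) (a : S),
    Function.Injective i ∧ ∀ f e : C, f ≠ 1 → e ≠ 1 →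
      Function.Injective (FreeGroup.lift (ppGen a (i f * a * i e))) ∧
      (∀ c, c ≠ 1 → i c ∉ (FreeGroup.lift (ppGen a (i f * a * i e))).range) ∧
      (∀ d, d ≠ 1 → d ≠ f → ∀ j : ℕ, j ≠ 0 →
        (a * i d) ^ j ∉ (FreeGroup.lift (ppGen a (i f * a * i e))).range) := by
  obtain ⟨a, ha, ha'⟩ := pp_perm C
  refine ⟨Equiv.Perm (PPSet C), inferInstance, ppAct C, a, ?_, ?_⟩
  · intro c d h
    have := congrArg (fun (s : Equiv.Perm (PPSet C)) => (s (1, 0, [])).1) h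
    simpa [ppAct_apply] using this
  intro f e hf he
  set z := ppAct C f * a * ppAct C e with hz
  set o : PPSet C := (1, 2, []) with ho
  have hoR : ∀ (c : C) p, ¬ ppReg f e p (ppAct C c o) := by
    intro c p
    rcases p with ⟨_ | _, _ | _⟩ <;> simp [ppReg, ppAct_apply, ho]
  have hoR' : ∀ p, ¬ ppReg f e p o := by
    intro p
    have := hoR 1 p
    simpa using this
  have hstep : ∀ (x b : Bool) (ω : PPSet C), ¬ ppReg f e (x, !b) ω →
      ppReg f e (x, b) ((bif b then ppGen a z x else (ppGen a z x)⁻¹) ω) := by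
    intro x b ω h
    rcases x with _ | _ <;> rcases b with _ | _
    · exact ha' ω h
    · exact ha ω h
    · have hzi : z⁻¹ ω = ppAct C e⁻¹ (a⁻¹ (ppAct C f⁻¹ ω)) := by
        simp [hz, mul_inv_rev]
      have := ha' (ppAct C f⁻¹ ω) (by
        intro h2
        apply h
        simp only [ppAct_apply] at h2
        exact ⟨(inv_mul_eq_one.mp h2.1).symm, h2.2⟩)
      simp only [ppGen, cond_true, cond_false, hzi, ppReg, ppAct_apply]
      simp only [ppAct_apply] at this
      exact ⟨by rw [this.1, mul_one], this.2⟩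
    · have hzi : z ω = ppAct C f (a (ppAct C e ω)) := by
        simp [hz]
      have := ha (ppAct C e ω) (by
        intro h2
        apply h
        simp only [ppAct_apply] at h2
        exact ⟨(inv_eq_of_mul_eq_one_right h2.1).symm, h2.2⟩)
      simp only [ppGen, cond_true, hzi, ppReg, ppAct_apply]
      simp only [ppAct_apply] at this
      exact ⟨by rw [this.1, mul_one], this.2⟩
  have hword : ∀ (L : List (Bool × Bool)) (p : Bool × Bool), FreeGroup.IsReduced (p :: L) →
      ppReg f e p (FreeGroup.lift (ppGen a z) (FreeGroup.mk (p :: L)) o) := by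
    intro L
    induction L with
    | nil =>
      rintro ⟨x, b⟩ -
      have := hstep x b o (hoR' _)
      simpa [FreeGroup.lift_mk] using this
    | cons q L ih =>
      rintro ⟨x, b⟩ h
      rw [FreeGroup.isReduced_cons_cons] at h
      have h2 := ih q h.2
      have h3 := hstep x b _ (fun hh => by
        have := ppReg_disj hf he _ _ _ h2 hh
        subst this
        have := h.1 rfl
        simp at this)
      rw [FreeGroup.lift_mk] at h3 ⊢
      rw [List.map_cons, List.prod_cons]
      exact h3
  have hone : ∀ L : List (Bool × Bool), FreeGroup.IsReduced L → L = [] ∨ ∃ p,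
      ppReg f e p (FreeGroup.lift (ppGen a z) (FreeGroup.mk L) o) := by
    intro L hL
    rcases L with _ | ⟨p, L⟩
    · exact Or.inl rfl
    · exact Or.inr ⟨p, hword L p hL⟩
  have hC : ∀ (w : FreeGroup Bool) (c : C), FreeGroup.lift (ppGen a z) w = ppAct C c → w = 1 := by
    intro w c hw
    rcases hone w.toWord FreeGroup.isReduced_toWord with h | ⟨p, h⟩
    · exact FreeGroup.toWord_eq_nil_iff.mp h
    · rw [FreeGroup.mk_toWord, hw] at h
      exact absurd h (hoR _ _)
  have hinj : Function.Injective (ppAct C) := by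
    intro c d h
    have := congrArg (fun (s : Equiv.Perm (PPSet C)) => (s (1, 0, [])).1) h
    simpa [ppAct_apply] using this
  refine ⟨?_, ?_, ?_⟩
  · rw [injective_iff_map_eq_one]
    intro w hw
    exact hC w 1 (by rw [hw, map_one])
  · rintro c hc ⟨w, hw⟩
    have := hC w c hw
    subst this
    rw [map_one] at hw
    exact hc (hinj (by rw [← hw, map_one]))
  · rintro d hd hdf j hj ⟨w, hw⟩
    have hpow : ∀ j : ℕ, ((a * ppAct C d) ^ j) o = o ∨
        ((((a * ppAct C d) ^ j) o).1 = 1 ∧ (((a * ppAct C d) ^ j) o).2.1 = 0) := by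
      intro j
      induction j with
      | zero => left; simp
      | succ j ih =>
        right
        rw [pow_succ', Equiv.Perm.mul_apply, Equiv.Perm.mul_apply]
        apply ha
        rintro ⟨-, h2⟩
        rw [ppAct_apply] at h2
        rcases ih with ih | ih
        · rw [ih] at h2; simp [ho] at h2
        · rw [ih.2] at h2; simp at h2
    obtain ⟨j, rfl⟩ := Nat.exists_eq_succ_of_ne_zero hj
    have hfirst : ppReg f e (false, true) (((a * ppAct C d) ^ (j + 1)) o) := by
      rcases hpow (j + 1) with h | h
      · exfalso
        have h1 : ppReg f e (false, true) (((a * ppAct C d) ^ (j + 1)) o) := by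
          rw [pow_succ', Equiv.Perm.mul_apply, Equiv.Perm.mul_apply]
          apply ha
          rintro ⟨-, h2⟩
          rw [ppAct_apply] at h2
          rcases hpow j with ih | ih
          · rw [ih] at h2; simp [ho] at h2
          · rw [ih.2] at h2; simp at h2
        rw [h] at h1
        exact hoR' _ h1
      · exact h
    rw [← FreeGroup.mk_toWord (x := w)] at hw
    have hred := FreeGroup.isReduced_toWord (x := w)
    generalize w.toWord = L at hw hred
    rcases L with _ | ⟨p, L⟩
    · have : (FreeGroup.mk ([] : List (Bool × Bool))) = 1 := rfl
      rw [this, map_one] at hw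
      rw [← Nat.succ_eq_add_one, ← hw] at hfirst
      exact hoR' _ hfirst
    · have h1 := hword L p hred
      rw [hw] at h1
      have := ppReg_disj hf he _ _ _ h1 hfirst
      subst this
      have hw2 : FreeGroup.lift (ppGen a z) (FreeGroup.mk L) = ppAct C d * (a * ppAct C d) ^ j := by
        rw [FreeGroup.lift_mk, List.map_cons, List.prod_cons, Nat.succ_eq_add_one, pow_succ',
          mul_assoc a] at hw
        rw [FreeGroup.lift_mk]
        exact mul_left_cancel hw
      have hredL : FreeGroup.IsReduced L := hred.infix ⟨[(false, true)], [], by simp⟩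
      rcases hone L hredL with h | ⟨p, h⟩
      · subst h
        have h0 : (FreeGroup.mk ([] : List (Bool × Bool))) = 1 := rfl
        rw [h0, map_one] at hw2
        have h3 := congrArg (fun (s : Equiv.Perm (PPSet C)) => s o) hw2
        simp only [Equiv.Perm.one_apply, Equiv.Perm.mul_apply, ppAct_apply] at h3
        rcases hpow j with ih | ih
        · rw [ih] at h3
          simp [ho] at h3
          exact hd h3.symm
        · have := congrArg (fun x => x.2.1) h3
          simp only [ih.2] at this
          simp [ho] at this
      · rw [hw2, Equiv.Perm.mul_apply, ppAct_apply] at h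
        rcases hpow j with ih | ih
        · rw [ih] at h
          exact hoR d p h
        · rcases p with ⟨_ | _, _ | _⟩ <;> simp only [ppReg, ih.1, ih.2, mul_one] at h
          · simp at h
          · exact hd h.1
          · simp at h
          · exact hdf h.1

/-- Products of reduced alternating words in an amalgamated product. -/
inductive GoodWord {ι : Type*} {G : ι → Type*} {H : Type*} [∀ i, Group (G i)] [Group H]
    (φ : ∀ i, H →* G i) : ι → ι → PushoutI φ → Prop
  | single (i : ι) (g : G i) (hg : g ∉ (φ i).range) : GoodWord φ i i (PushoutI.of i g)
  | app {i j k l : ι} {x y : PushoutI φ} (hx : GoodWord φ i j x) (hjk : j ≠ k)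
      (hy : GoodWord φ k l y) : GoodWord φ i l (x * y)

theorem GoodWord.exists_neWord {ι : Type*} {G : ι → Type*} {H : Type*} [∀ i, Group (G i)]
    [Group H] {φ : ∀ i, H →* G i} {i j : ι} {x : PushoutI φ} (h : GoodWord φ i j x) :
    ∃ w : CoprodI.NeWord G i j, PushoutI.ofCoprodI w.prod = x ∧
      ∀ g ∈ w.toList, g.2 ∉ (φ g.1).range := by
  induction h with
  | single i g hg =>
    refine ⟨CoprodI.NeWord.singleton g (fun h => hg (h ▸ one_mem _)), ?_, ?_⟩
    · simp
    · simpa [CoprodI.NeWord.toList] using hg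
  | app hx hjk hy ihx ihy =>
    obtain ⟨w, hw, hw'⟩ := ihx
    obtain ⟨v, hv, hv'⟩ := ihy
    refine ⟨w.append hjk v, ?_, ?_⟩
    · rw [CoprodI.NeWord.append_prod, map_mul, hw, hv]
    · intro g hg
      simp only [CoprodI.NeWord.toList, List.mem_append] at hg
      rcases hg with hg | hg
      · exact hw' g hg
      · exact hv' g hg

theorem GoodWord.ne_one {ι : Type*} {G : ι → Type*} {H : Type*} [∀ i, Group (G i)]
    [Group H] {φ : ∀ i, H →* G i} (hφ : ∀ i, Function.Injective (φ i)) {i j : ι}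
    {x : PushoutI φ} (h : GoodWord φ i j x) : x ≠ 1 := by
  rintro rfl
  obtain ⟨w, hw, hw'⟩ := h.exists_neWord
  have : w.toWord = CoprodI.Word.empty :=
    PushoutI.Reduced.eq_empty_of_mem_range hφ (w := w.toWord) hw' (by
      change PushoutI.ofCoprodI w.prod ∈ _
      rw [hw]; exact one_mem _)
  exact w.toList_ne_nil (congrArg CoprodI.Word.toList this)

theorem GoodWord.lift_injective {ι : Type*} {G M : ι → Type*} {H : Type*} [∀ i, Group (G i)]
    [∀ i, Group (M i)]
    [Group H] {φ : ∀ i, H →* G i} (hφ : ∀ i, Function.Injective (φ i))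
    (f : ∀ i, M i →* PushoutI φ) (hf : ∀ i m, m ≠ 1 → GoodWord φ i i (f i m)) :
    Function.Injective (CoprodI.lift f) := by
  classical
  have key : ∀ i j (w : CoprodI.NeWord M i j), GoodWord φ i j (CoprodI.lift f w.prod) := by
    intro i j w
    induction w with
    | singleton x hx => simpa using hf _ x hx
    | append w₁ hne w₂ ih1 ih2 =>
      rw [CoprodI.NeWord.append_prod, map_mul]
      exact GoodWord.app ih1 hne ih2
  rw [injective_iff_map_eq_one]
  intro x hx
  by_contra hne
  obtain ⟨w, rfl⟩ : ∃ w : CoprodI.Word M, w.prod = x :=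
    ⟨CoprodI.Word.equiv x, CoprodI.Word.equiv.symm_apply_apply x⟩
  obtain ⟨i, j, w', rfl⟩ := CoprodI.NeWord.of_word w (by
    rintro rfl
    exact hne CoprodI.Word.prod_empty)
  exact (key i j w').ne_one hφ hx

/-- two-element family of groups -/
def Fam (S R : Type u) : Bool → Type u
  | true => S
  | false => R

instance Fam.group (S R : Type u) [hS : Group S] [hR : Group R] : ∀ b, Group (Fam S R b)
  | true => hS
  | false => hR

/-- homs into a two-element family -/
def Fam.hom {S R : Type u} {H : Type*} [Group S] [Group R] [Group H] (f : H →* S) (g : H →* R) :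
    ∀ b, H →* Fam S R b
  | true => f
  | false => g

theorem Fam.hom_injective {S R : Type u} {H : Type*} [Group S] [Group R] [Group H] {f : H →* S}
    {g : H →* R} (hf : Function.Injective f) (hg : Function.Injective g) :
    ∀ b, Function.Injective (Fam.hom f g b)
  | true => hf
  | false => hg

/-- homs out of a two-element family -/
def Fam.out {S R : Type u} {H : Type*} [Group S] [Group R] [Group H] (f : S →* H) (g : R →* H) :
    ∀ b, Fam S R b →* H
  | true => f
  | false => g

theorem exists_amalgam {S R : Type u} {H : Type u} [Group S] [Group R] [Group H] (f : H →* S)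
    (g : H →* R) (hf : Function.Injective f) (hg : Function.Injective g) :
    ∃ (Q : Type u) (_ : Group Q) (i : S →* Q) (j : R →* Q), Function.Injective i ∧
      Function.Injective j ∧ ∀ h, i (f h) = j (g h) := by
  refine ⟨PushoutI (Fam.hom f g), inferInstance,
    (PushoutI.of (φ := Fam.hom f g) true : Fam S R true →* _),
    (PushoutI.of (φ := Fam.hom f g) false : Fam S R false →* _),
    PushoutI.of_injective (Fam.hom_injective hf hg) true,
    PushoutI.of_injective (Fam.hom_injective hf hg) false, ?_⟩
  intro h
  exact (PushoutI.of_apply_eq_base (Fam.hom f g) true h).trans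
    (PushoutI.of_apply_eq_base (Fam.hom f g) false h).symm

/-- Version of the amalgam with the embedding criterion for free products. -/
theorem exists_amalgam' {S R : Type u} {H : Type} [Group S] [Group R] [Group H] (f : H →* S)
    (g : H →* R) (hf : Function.Injective f) (hg : Function.Injective g) :
    ∃ (Q : Type u) (_ : Group Q) (i : S →* Q) (j : R →* Q), Function.Injective i ∧
      Function.Injective j ∧ (∀ h, i (f h) = j (g h)) ∧
      ∀ (X T : Type u) [Group X] [Group T] (k : X →* Q) (l : T →* Q),
        (∀ x, x ≠ 1 → (∃ s, s ∉ f.range ∧ k x = i s) ∨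
          ∃ s r s', s ∉ f.range ∧ r ∉ g.range ∧ s' ∉ f.range ∧ k x = i s * j r * i s') →
        (∀ t, t ≠ 1 → ∃ r, r ∉ g.range ∧ l t = j r) →
        Function.Injective (CoprodI.lift (Fam.out k l)) := by
  refine ⟨PushoutI (Fam.hom f g), inferInstance,
    (PushoutI.of (φ := Fam.hom f g) true : Fam S R true →* _),
    (PushoutI.of (φ := Fam.hom f g) false : Fam S R false →* _),
    PushoutI.of_injective (Fam.hom_injective hf hg) true,
    PushoutI.of_injective (Fam.hom_injective hf hg) false, ?_, ?_⟩
  · intro h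
    exact (PushoutI.of_apply_eq_base (Fam.hom f g) true h).trans
      (PushoutI.of_apply_eq_base (Fam.hom f g) false h).symm
  · intro X T _ _ k l hk hl
    apply GoodWord.lift_injective (Fam.hom_injective hf hg)
    intro b m hm
    cases b with
    | true =>
      have hk' := hk m hm
      change GoodWord _ _ _ (k m)
      rcases hk' with ⟨s, hs, h⟩ | ⟨s, r, s', hs, hr, hs', h⟩
      · rw [h]
        exact GoodWord.single (φ := Fam.hom f g) true s hs
      · rw [h]
        exact ((GoodWord.single (φ := Fam.hom f g) true s hs).app (by simp)
          (GoodWord.single (φ := Fam.hom f g) false r hr)).app (by simp)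
          (GoodWord.single (φ := Fam.hom f g) true s' hs')
    | false =>
      obtain ⟨r, hr, h⟩ := hl m hm
      change GoodWord _ _ _ (l m)
      rw [h]
      exact GoodWord.single (φ := Fam.hom f g) false r hr


/-- The auxiliary overgroup of `C`. -/
theorem exists_over {C X T : Type u} [Group C] [Group X] [Group T] (c₁ c₂ : C) (hc₁ : c₁ ≠ 1)
    (hc₂ : c₂ ≠ 1) (hc : c₁ * c₂ ≠ 1) (U : X) (hUi : Function.Injective (fun n : ℤ => U ^ n))
    (hUs : Function.Surjective (fun n : ℤ => U ^ n)) (γ : T) (hγ : γ ≠ 1) (ε : ℤ)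
    (hε : ε = 1 ∨ ε = -1) :
    ∃ (Q : Type u) (_ : Group Q) (i : C →* Q) (k : X →* Q) (l : T →* Q), Function.Injective i ∧
      Function.Injective (CoprodI.lift (Fam.out k l)) ∧
      i c₁ * k U * i c₂ * k (U ^ (-2 * ε)) * l γ = 1 := by
  obtain ⟨S, _, iS, a, hiS, hS⟩ := exists_pp C
  obtain ⟨R, _, iR, b, hiR, hR⟩ := exists_pp T
  have he : c₁ * c₂ * c₁⁻¹ ≠ 1 := by
    intro h; exact hc₂ (conj_eq_one_iff.1 h)
  obtain ⟨hS1, hS2, hS3⟩ := hS c₁ (c₁ * c₂ * c₁⁻¹) hc₁ he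
  obtain ⟨hR1, hR2, -⟩ := hR γ⁻¹ γ⁻¹ (inv_ne_one.2 hγ) (inv_ne_one.2 hγ)
  set φS := FreeGroup.lift (ppGen a (iS c₁ * a * iS (c₁ * c₂ * c₁⁻¹))) with hφS
  set ρ := FreeGroup.lift (ppGen b (iR γ⁻¹ * b * iR γ⁻¹)) with hρ
  let θ : FreeGroup Bool →* FreeGroup Bool := FreeGroup.lift
    (ppGen (FreeGroup.of false) ((FreeGroup.of true * FreeGroup.of false) ^ ε))
  let θ' : FreeGroup Bool →* FreeGroup Bool := FreeGroup.lift
    (ppGen (FreeGroup.of false) (FreeGroup.of true ^ ε * (FreeGroup.of false)⁻¹))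
  have hθ : Function.LeftInverse θ' θ := by
    have : θ'.comp θ = MonoidHom.id _ := by
      ext x
      cases x
      · simp [θ, θ', ppGen]
      · rcases hε with rfl | rfl <;> simp [θ, θ', ppGen]
    intro x
    exact DFunLike.congr_fun this x
  have hφR : Function.Injective (ρ.comp θ) := hR1.comp hθ.injective
  obtain ⟨Q, _, i, j, hi, hj, hij, hcrit⟩ := exists_amalgam' φS (ρ.comp θ) hS1 hφR
  have hrange : ∀ r, r ∉ ρ.range → r ∉ (ρ.comp θ).range := by
    rintro r hr ⟨x, rfl⟩
    exact hr ⟨θ x, rfl⟩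
  have h1 : i a = j b := by
    have := hij (FreeGroup.of false)
    simpa [hφS, hρ, θ, ppGen] using this
  have h2 : i (iS c₁ * a * iS (c₁ * c₂ * c₁⁻¹)) = (j (iR γ⁻¹ * b) ^ 2) ^ ε := by
    have := hij (FreeGroup.of true)
    simp only [hφS, hρ, θ, ppGen, MonoidHom.comp_apply, FreeGroup.lift_apply_of, cond_true,
      map_zpow, map_mul, cond_false] at this
    simp only [map_mul, pow_two]
    simpa only [mul_assoc, map_mul] using this
  have hε2 : ε * ε = 1 := by rcases hε with rfl | rfl <;> rfl
  set s : Q := j (iR γ⁻¹ * b) with hs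
  set u : Q := (i (iS c₁))⁻¹ * s * i (iS c₁) with hu
  have hconj : ∀ m : ℤ, u ^ m = (i (iS c₁))⁻¹ * s ^ m * i (iS c₁) := by
    intro m
    have := conj_zpow (a := (i (iS c₁))⁻¹) (b := s) (i := m)
    rw [inv_inv] at this
    rw [hu, this]
  have hu2 : u ^ (2 * ε) = i (a * iS (c₁ * c₂)) := by
    rw [hconj, zpow_mul, zpow_ofNat, ← h2]
    simp [mul_assoc]
  let eU : Multiplicative ℤ ≃* X := MulEquiv.ofBijective (zpowersHom X U) ⟨hUi, hUs⟩
  let k : X →* Q := (zpowersHom Q u).comp eU.symm.toMonoidHom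
  have hk : ∀ m : ℤ, k (U ^ m) = u ^ m := by
    intro m
    have : eU.symm (U ^ m) = Multiplicative.ofAdd m := by
      rw [MulEquiv.symm_apply_eq]; rfl
    simp [k, this]
  have hk1 : k U = u := by simpa using hk 1
  refine ⟨Q, inferInstance, i.comp iS, k, j.comp iR, hi.comp hiS, ?_, ?_⟩
  · apply hcrit
    · intro x hx
      obtain ⟨m, rfl⟩ := hUs x
      have hm : m ≠ 0 := by rintro rfl; simp at hx
      simp only [hk]
      rcases Int.even_or_odd' m with ⟨p, rfl | rfl⟩
      · left
        refine ⟨(a * iS (c₁ * c₂)) ^ (ε * p), ?_, ?_⟩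
        · have hd := hS3 (c₁ * c₂) hc (by simpa using hc₂)
          intro hmem
          have hp : ε * p ≠ 0 := by
            rcases hε with rfl | rfl <;> simpa using hm
          rcases Int.natAbs_eq (ε * p) with h | h
          · rw [h, zpow_natCast] at hmem
            exact hd _ (Int.natAbs_ne_zero.2 hp) hmem
          · rw [h, zpow_neg, zpow_natCast] at hmem
            exact hd _ (Int.natAbs_ne_zero.2 hp) ((Subgroup.inv_mem_iff _).1 hmem)
        · rw [map_zpow, ← hu2, ← zpow_mul]
          congr 1
          linear_combination (-2 * p) * hε2
      · right
        refine ⟨(iS c₁)⁻¹, (iR γ⁻¹ * b) ^ (2 * p + 1), iS c₁, ?_, hrange _ ?_, hS2 _ hc₁, ?_⟩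
        · intro h
          exact hS2 _ hc₁ ((Subgroup.inv_mem_iff _).1 h)
        · intro h
          have hb : b ∈ ρ.range := ⟨FreeGroup.of false, by simp [hρ, ppGen]⟩
          have hz : iR γ⁻¹ * b * iR γ⁻¹ ∈ ρ.range := ⟨FreeGroup.of true, by simp [hρ, ppGen]⟩
          have hsq : (iR γ⁻¹ * b) ^ 2 ∈ ρ.range := by
            have := mul_mem hz hb
            rwa [mul_assoc, ← pow_two] at this
          rw [zpow_add, zpow_mul, zpow_ofNat, zpow_one,
            Subgroup.mul_mem_cancel_left _ (Subgroup.zpow_mem _ hsq p),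
            Subgroup.mul_mem_cancel_right _ hb] at h
          exact hR2 _ (inv_ne_one.2 hγ) h
        · rw [hconj, hs]
          simp only [map_inv, map_zpow]
    · intro t ht
      exact ⟨iR t, hrange _ (hR2 _ ht), rfl⟩
  · have hneg : k (U ^ (-2 * ε)) = (i (a * iS (c₁ * c₂)))⁻¹ := by
      rw [hk, ← hu2, ← zpow_neg]; congr 1; ring
    rw [hneg, hk1, hu, hs]
    simp only [MonoidHom.comp_apply, map_mul, map_inv, h1]
    group


/-- The embedding result in terms of `P = A*B`. -/
theorem exists_final {P C : Type u} [Group P] [Group C] (c₁ c₂ : C) (hc₁ : c₁ ≠ 1)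
    (hc₂ : c₂ ≠ 1) (hc : c₁ * c₂ ≠ 1) (U γ : P) (hU : orderOf U = 0) (hγ : γ ≠ 1)
    (hfree : Function.Injective (Monoid.Coprod.lift (Subgroup.zpowers U).subtype
      (Subgroup.zpowers γ).subtype)) (ε : ℤ) (hε : ε = 1 ∨ ε = -1) :
    ∃ (Q : Type u) (_ : Group Q) (p : P →* Q) (i : C →* Q), Function.Injective p ∧
      Function.Injective i ∧ i c₁ * p U * i c₂ * p (U ^ (-2 * ε) * γ) = 1 := by
  let U' : Subgroup.zpowers U := ⟨U, Subgroup.mem_zpowers U⟩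
  let γ' : Subgroup.zpowers γ := ⟨γ, Subgroup.mem_zpowers γ⟩
  have hγ' : γ' ≠ 1 := fun h => hγ (congrArg Subtype.val h)
  have hinj : Function.Injective (fun n : ℤ => U ^ n) := by
    rw [injective_zpow_iff_not_isOfFinOrder]
    exact orderOf_eq_zero_iff.1 hU
  obtain ⟨Q, _, i, k, l, hi, hkl, hrel⟩ := exists_over c₁ c₂ hc₁ hc₂ hc U'
    (fun m n h => hinj (congrArg Subtype.val h))
    (by
      rintro ⟨_, n, rfl⟩
      exact ⟨n, Subtype.ext rfl⟩) γ' hγ' ε hε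
  let X := Subgroup.zpowers U
  let T := Subgroup.zpowers γ
  let F : CoprodI (Fam X T) →* P := CoprodI.lift (Fam.out X.subtype T.subtype)
  have hF : Function.Injective F := by
    let e : CoprodI (Fam X T) →* Coprod X T := CoprodI.lift (Fam.out Coprod.inl Coprod.inr)
    let e' : Coprod X T →* CoprodI (Fam X T) := Coprod.lift
      (CoprodI.of (i := true) : Fam X T true →* CoprodI (Fam X T))
      (CoprodI.of (i := false) : Fam X T false →* CoprodI (Fam X T))
    have he : e'.comp e = MonoidHom.id _ := by
      apply CoprodI.ext_hom
      intro b
      ext x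
      cases b
      · simp only [MonoidHom.comp_apply, e, CoprodI.lift_of]
        exact Coprod.lift_apply_inr _ _ _
      · simp only [MonoidHom.comp_apply, e, CoprodI.lift_of]
        exact Coprod.lift_apply_inl _ _ _
    have hFe : F = (Coprod.lift X.subtype T.subtype).comp e := by
      apply CoprodI.ext_hom
      intro b
      ext x
      cases b
      · simp only [MonoidHom.comp_apply, e, F, CoprodI.lift_of]
        exact (Coprod.lift_apply_inr _ _ _).symm
      · simp only [MonoidHom.comp_apply, e, F, CoprodI.lift_of]
        exact (Coprod.lift_apply_inl _ _ _).symm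
    rw [hFe]
    exact hfree.comp (Function.LeftInverse.injective (g := e') fun x => DFunLike.congr_fun he x)
  obtain ⟨Γ, _, p, q, hp, hq, hpq⟩ := exists_amalgam F (CoprodI.lift (Fam.out k l)) hF hkl
  have hX : ∀ x : X, p x = q (k x) := by
    intro x
    have := hpq (CoprodI.of (i := true) x)
    simp only [F, CoprodI.lift_of] at this
    exact this
  have hT : ∀ x : T, p x = q (l x) := by
    intro x
    have := hpq (CoprodI.of (i := false) x)
    simp only [F, CoprodI.lift_of] at this
    exact this
  refine ⟨Γ, inferInstance, p, q.comp i, hp, hq.comp hi, ?_⟩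
  have e1 : p U = q (k U') := hX U'
  have e2 : p (U ^ (-2 * ε)) = q (k (U' ^ (-2 * ε))) := hX (U' ^ (-2 * ε))
  have e3 : p γ = q (l γ') := hT γ'
  rw [map_mul, e1, e2, e3]
  have := congrArg q hrel
  simpa only [map_mul, map_one, MonoidHom.comp_apply, mul_assoc] using this


/-- **Lemma 5.11 (Chinyere–Howie).** Setup as in Lemma 5.10.  If moreover `β⁻¹β₂` has
finite order `n > 1` and the subgroup of `A*B` generated by `U` and `β⁻¹β₂` is the
internal free product of the infinite cyclic subgroup `⟨U⟩` and the finite cyclic subgroup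
`⟨β⁻¹β₂⟩` (i.e. `{U, β⁻¹β₂}` is Nielsen reduced, so `⟨U,V⟩ ≅ ℤ * ℤ/n`), then each
of `A*B` and `C` embeds in `G` via the natural map. -/
theorem lemma_5_11
    {G : Fin 3 → Type*} [∀ i, Group (G i)] [∀ i, Nontrivial (G i)]
    (α : subFamily G 0) (hα : α ≠ 1) (hA : Subgroup.zpowers α = ⊤)
    (β β₂ : subFamily G 1) (hβ : β ≠ 1) (hβ₂ : β₂ ≠ 1) (hβne : β ≠ β₂)
    (c₁ c₂ : G 2) (hc₁ : c₁ ≠ 1) (hc₂ : c₂ ≠ 1) (hc₁c₂ : c₁ * c₂ ≠ 1)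
    (hC : Subgroup.closure {c₁, c₂} = ⊤)
    (U V : Monoid.CoprodI (subFamily G))
    (hU : U = (Monoid.CoprodI.of : subFamily G 0 →* Monoid.CoprodI (subFamily G)) α * (Monoid.CoprodI.of : subFamily G 1 →* Monoid.CoprodI (subFamily G)) β ∨
      U = ((Monoid.CoprodI.of : subFamily G 0 →* Monoid.CoprodI (subFamily G)) α * (Monoid.CoprodI.of : subFamily G 1 →* Monoid.CoprodI (subFamily G)) β)⁻¹)
    (hV : V = (Monoid.CoprodI.of : subFamily G 0 →* Monoid.CoprodI (subFamily G)) α * (Monoid.CoprodI.of : subFamily G 1 →* Monoid.CoprodI (subFamily G)) β * (Monoid.CoprodI.of : subFamily G 0 →* Monoid.CoprodI (subFamily G)) α * (Monoid.CoprodI.of : subFamily G 1 →* Monoid.CoprodI (subFamily G)) β₂)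
    (n : ℕ) (hn : 1 < n) (horder : orderOf (β⁻¹ * β₂) = n)
    (hUinf : orderOf U = 0)
    (hfree : Function.Injective
      (Monoid.Coprod.lift (Subgroup.zpowers U).subtype
        (Subgroup.zpowers ((Monoid.CoprodI.of : subFamily G 1 →* Monoid.CoprodI (subFamily G)) (β⁻¹ * β₂))).subtype))
    :
    Function.Injective
        ((QuotientGroup.mk' (Subgroup.normalClosure
            {(Monoid.CoprodI.of : G 2 →* Monoid.CoprodI G) c₁ * CoprodI.embed G U *
              (Monoid.CoprodI.of : G 2 →* Monoid.CoprodI G) c₂ * CoprodI.embed G V})).comp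
          (CoprodI.embed G)) ∧
      Function.Injective
        ((QuotientGroup.mk' (Subgroup.normalClosure
            {(Monoid.CoprodI.of : G 2 →* Monoid.CoprodI G) c₁ * CoprodI.embed G U *
              (Monoid.CoprodI.of : G 2 →* Monoid.CoprodI G) c₂ * CoprodI.embed G V})).comp
          (Monoid.CoprodI.of : G 2 →* Monoid.CoprodI G)) := by
  have key : ∀ γ : CoprodI (subFamily G), γ = CoprodI.of (i := (1 : Fin 2)) (β⁻¹ * β₂) →
      ∃ ε : ℤ, (ε = 1 ∨ ε = -1) ∧ V = U ^ (-2 * ε) * γ := by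
    rintro γ rfl
    rcases hU with rfl | rfl
    · refine ⟨-1, Or.inr rfl, ?_⟩
      rw [hV, map_mul, map_inv]
      norm_num
      rw [pow_two]
      group
    · refine ⟨1, Or.inl rfl, ?_⟩
      rw [hV, map_mul, map_inv]
      norm_num
      rw [pow_two]
      group
  obtain ⟨ε, hε, hVε⟩ := key _ rfl
  have hγ : (Monoid.CoprodI.of : subFamily G 1 →* Monoid.CoprodI (subFamily G)) (β⁻¹ * β₂) ≠ 1 := by
    intro h
    rw [← map_one (Monoid.CoprodI.of : subFamily G 1 →* Monoid.CoprodI (subFamily G))] at h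
    have := CoprodI.of_injective _ h
    exact hβne (inv_mul_eq_one.1 this)
  obtain ⟨Γ, _, p, q, hp, hq, hrel⟩ := exists_final c₁ c₂ hc₁ hc₂ hc₁c₂ U _ hUinf hγ hfree ε hε
  rw [← hVε] at hrel
  let Φ : CoprodI G →* Γ := CoprodI.lift (fun i => Fin.lastCases (motive := fun i => G i →* Γ) q
    (fun i => p.comp (CoprodI.of (M := subFamily G) (i := i))) i)
  have hΦ1 : Φ.comp (CoprodI.embed G) = p := by
    apply CoprodI.ext_hom
    intro i
    ext x
    simp only [MonoidHom.comp_apply, CoprodI.embed, CoprodI.lift_of, Φ]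
    refine (CoprodI.lift_of (i := i.castSucc) _ _).trans ?_
    rw [Fin.lastCases_castSucc]
    rfl
  have hΦ2 : Φ.comp (CoprodI.of (i := (2 : Fin 3))) = q := by
    ext x
    simp only [MonoidHom.comp_apply, Φ]
    refine (CoprodI.lift_of (i := Fin.last 2) _ _).trans ?_
    rw [Fin.lastCases_last]
  have a1 : ∀ x, Φ (CoprodI.embed G x) = p x := fun x => DFunLike.congr_fun hΦ1 x
  have a2 : ∀ x : G 2, Φ (CoprodI.of x) = q x := fun x => DFunLike.congr_fun hΦ2 x
  have hker : Subgroup.normalClosure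
            {(Monoid.CoprodI.of : G 2 →* Monoid.CoprodI G) c₁ * CoprodI.embed G U *
              (Monoid.CoprodI.of : G 2 →* Monoid.CoprodI G) c₂ * CoprodI.embed G V} ≤ Φ.ker := by
    apply Subgroup.normalClosure_le_normal
    rintro _ rfl
    show Φ _ = 1
    rw [map_mul, map_mul, map_mul, a1, a1, a2, a2, hrel]
  constructor
  · intro x y h
    apply hp
    have := congrArg (QuotientGroup.lift _ Φ hker) h
    simpa only [MonoidHom.comp_apply, QuotientGroup.mk'_apply, QuotientGroup.lift_mk, a1] using this
  · intro x y h
    apply hq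
    have := congrArg (QuotientGroup.lift _ Φ hker) h
    simpa only [MonoidHom.comp_apply, QuotientGroup.mk'_apply, QuotientGroup.lift_mk, a2] using this
end

section
/- Let C be a group, let c₁, c₂ be nontrivial elements of C with c₁c₂ ≠ 1, let n ≥ 2 be an integer, and let ε ∈ {+1, −1}. Let F = ⟨t⟩ be an infinite cyclic group and H = (C * F)/N((t^{2ε} c₁ t c₂)ⁿ). Then the subgroup of H generated by the images of t and c₁tc₂ is the internal free product of the infinite cyclic subgroup generated by the image of t and the cyclic subgroup of order exactly n generated by the image of t^{2ε}c₁tc₂; in particular this subgroup is isomorphic to ℤ * ℤ/n. -/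
open Monoid

namespace RelPres

universe u v w

/-- Nonempty alternating products of elements of `S true` and `S false`. -/
inductive Alt {M : Type u} [Group M] (S : Bool → M → Prop) : Bool → Bool → M → Prop
  | single {i : Bool} {x : M} : S i x → Alt S i i x
  | cons {i j : Bool} {x y : M} : S i x → Alt S (!i) j y → Alt S i j (x * y)

/-- No nonempty alternating product is trivial. -/
def FreePair {M : Type u} [Group M] (S : Bool → M → Prop) : Prop :=
  ∀ i j x, Alt S i j x → x ≠ 1

section
variable {M : Type u} [Group M] {S : Bool → M → Prop}

theorem Alt.append {i j l : Bool} {x y : M} (h : Alt S i j x) (h' : Alt S (!j) l y) :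
    Alt S i l (x * y) := by
  induction h with
  | single hx => exact .cons hx h'
  | cons hx _ ih => rw [mul_assoc]; exact .cons hx (ih h')

theorem Alt.inv (hS : ∀ i x, S i x → S i x⁻¹) {i j : Bool} {x : M} (h : Alt S i j x) :
    Alt S j i x⁻¹ := by
  induction h with
  | single hx => exact .single (hS _ _ hx)
  | cons hx _ ih =>
    rw [mul_inv_rev]
    refine Alt.append ih ?_
    rw [Bool.not_not]
    exact .single (hS _ _ hx)

theorem Alt.comp {T : Bool → M → Prop} (hT : ∀ i x, T i x → Alt S i i x) {i j : Bool} {x : M}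
    (h : Alt T i j x) : Alt S i j x := by
  induction h with
  | single hx => exact hT _ _ hx
  | cons hx _ ih => exact (hT _ _ hx).append ih

theorem Alt.map {N : Type v} [Group N] (f : M →* N) {T : Bool → N → Prop}
    (hT : ∀ i x, S i x → T i (f x)) {i j : Bool} {x : M}
    (h : Alt S i j x) : Alt T i j (f x) := by
  induction h with
  | single hx => exact .single (hT _ _ hx)
  | cons hx _ ih => rw [map_mul]; exact .cons (hT _ _ hx) ih

theorem FreePair.comp (hS : FreePair S) {T : Bool → M → Prop}
    (hT : ∀ i x, T i x → Alt S i i x) : FreePair T :=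
  fun i j x h => hS i j x (h.comp hT)

theorem pow_alt (hS : ∀ i x, S i x → S i x⁻¹) {i : Bool} {a b d : M} (ha : S i a) (hb : S i b)
    (hd : ∀ k : ℤ, k ≠ 0 → S (!i) (d ^ k)) (hab : b * a = 1 ∨ S i (b * a)) (k : ℤ) (hk : k ≠ 0) :
    Alt S i i ((a * d * b) ^ k) := by
  have hd1 : S (!i) d := by simpa using hd 1 one_ne_zero
  have hb' : Alt S (!(!i)) i b := by rw [Bool.not_not]; exact .single hb
  rcases hab with hab | hab
  · have hb1 : b = a⁻¹ := eq_inv_of_mul_eq_one_left hab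
    have : (a * d * b) ^ k = a * (d ^ k * b) := by
      rw [hb1, conj_zpow, mul_assoc]
    rw [this]
    exact .cons ha (.cons (hd k hk) hb')
  · have key : ∀ m : ℕ, ∃ Y, Alt S (!i) i Y ∧ (a * d * b) ^ (m + 1) = a * Y := by
      intro m
      induction m with
      | zero => exact ⟨d * b, .cons hd1 hb', by simp [mul_assoc]⟩
      | succ m ih =>
        obtain ⟨Y, hY, h⟩ := ih
        refine ⟨d * ((b * a) * Y), .cons hd1 ?_, ?_⟩
        · rw [Bool.not_not]; exact .cons hab hY
        · rw [pow_succ', h]; simp only [mul_assoc]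
    have key2 : ∀ m : ℕ, Alt S i i ((a * d * b) ^ (m + 1)) := by
      intro m
      obtain ⟨Y, hY, h⟩ := key m
      rw [h]; exact .cons ha hY
    rcases lt_or_gt_of_ne hk with h | h
    · obtain ⟨m, hm⟩ : ∃ m : ℕ, k = -((m + 1 : ℕ) : ℤ) := ⟨(-k - 1).toNat, by omega⟩
      rw [hm, zpow_neg, zpow_natCast]
      exact (key2 m).inv hS
    · obtain ⟨m, hm⟩ : ∃ m : ℕ, k = ((m + 1 : ℕ) : ℤ) := ⟨(k - 1).toNat, by omega⟩
      rw [hm, zpow_natCast]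
      exact key2 m
end

/-- Two-element family of groups. -/
def Fam (X : Type u) (Y : Type v) : Bool → Type (max u v)
  | true => ULift.{v} X
  | false => ULift.{u} Y

instance famGroup (X : Type u) (Y : Type v) [Group X] [Group Y] : ∀ i, Group (Fam X Y i)
  | true => inferInstanceAs (Group (ULift.{v} X))
  | false => inferInstanceAs (Group (ULift.{u} Y))

/-- Letters for an amalgam. -/
def AmS {E : Type w} {X : Type u} {Y : Type v} {G : Type*} [Group E] [Group X] [Group Y] [Group G]
    (φ : E →* X) (ψ : E →* Y) (p : X →* G) (q : Y →* G) : Bool → G → Prop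
  | true => fun g => ∃ x, x ∉ φ.range ∧ g = p x
  | false => fun g => ∃ y, y ∉ ψ.range ∧ g = q y

theorem exists_amalgam {E : Type w} {X : Type u} {Y : Type v} [Group E] [Group X] [Group Y]
    (φ : E →* X) (ψ : E →* Y) (hφ : Function.Injective φ) (hψ : Function.Injective ψ) :
    ∃ (G : Type (max u v w)) (_ : Group G) (p : X →* G) (q : Y →* G),
      (∀ e, p (φ e) = q (ψ e)) ∧ FreePair (AmS φ ψ p q) := by
  let Φ : ∀ i, E →* Fam X Y i := fun i => match i with
    | true => (MulEquiv.ulift.symm.toMonoidHom : X →* ULift.{v} X).comp φ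
    | false => (MulEquiv.ulift.symm.toMonoidHom : Y →* ULift.{u} Y).comp ψ
  have hΦ : ∀ i, Function.Injective (Φ i) := by
    rintro (_ | _)
    · exact MulEquiv.ulift.symm.injective.comp hψ
    · exact MulEquiv.ulift.symm.injective.comp hφ
  let p : X →* PushoutI Φ := (PushoutI.of (φ := Φ) true).comp
    (MulEquiv.ulift.symm.toMonoidHom : X →* ULift.{v} X)
  let q : Y →* PushoutI Φ := (PushoutI.of (φ := Φ) false).comp
    (MulEquiv.ulift.symm.toMonoidHom : Y →* ULift.{u} Y)
  refine ⟨PushoutI Φ, inferInstance, p, q, ?_, ?_⟩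
  · intro e
    exact (PushoutI.of_apply_eq_base Φ true e).trans (PushoutI.of_apply_eq_base Φ false e).symm
  · have letter : ∀ i g, AmS φ ψ p q i g →
        ∃ x : Fam X Y i, x ∉ (Φ i).range ∧ PushoutI.of (φ := Φ) i x = g := by
      rintro (_ | _) g ⟨x, hx, rfl⟩
      · refine ⟨ULift.up x, ?_, rfl⟩
        rintro ⟨e, he⟩
        exact hx ⟨e, congrArg ULift.down he⟩
      · refine ⟨ULift.up x, ?_, rfl⟩
        rintro ⟨e, he⟩
        exact hx ⟨e, congrArg ULift.down he⟩
    have hemp : ∀ {i : Bool}, (CoprodI.Word.empty : CoprodI.Word (Fam X Y)).fstIdx ≠ some i := by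
      intro i h
      simp [CoprodI.Word.fstIdx, CoprodI.Word.empty] at h
    have key : ∀ i j g, Alt (AmS φ ψ p q) i j g → ∃ w : CoprodI.Word (Fam X Y),
        PushoutI.Reduced Φ w ∧ w.fstIdx = some i ∧ PushoutI.ofCoprodI (φ := Φ) w.prod = g := by
      intro i j g h
      induction h with
      | single hs =>
        obtain ⟨x, hx, rfl⟩ := letter _ _ hs
        have h1 : x ≠ 1 := fun h => hx (h ▸ one_mem _)
        refine ⟨CoprodI.Word.cons x CoprodI.Word.empty hemp h1, ?_, by simp, ?_⟩
        · intro g hg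
          simp [CoprodI.Word.cons, CoprodI.Word.empty] at hg
          subst hg; exact hx
        · rw [CoprodI.Word.prod_cons]; simp
      | @cons i j x y hs _ ih =>
        obtain ⟨w, hw, hi, rfl⟩ := ih
        obtain ⟨x, hx, rfl⟩ := letter _ _ hs
        have h1 : x ≠ 1 := fun h => hx (h ▸ one_mem _)
        refine ⟨CoprodI.Word.cons x w (by rw [hi]; simp) h1, ?_, by simp, ?_⟩
        · intro g hg
          simp only [CoprodI.Word.cons, List.mem_cons] at hg
          rcases hg with rfl | hg
          · exact hx
          · exact hw _ hg
        · rw [CoprodI.Word.prod_cons]; simp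
    intro i j g h h1
    obtain ⟨w, hw, hi, rfl⟩ := key i j g h
    have := hw.eq_empty_of_mem_range hΦ (by rw [h1]; exact one_mem _)
    subst this
    simp [CoprodI.Word.fstIdx, CoprodI.Word.empty] at hi

/-- Letters for a free product. -/
def CoS (X : Type u) (Y : Type v) [Group X] [Group Y] : Bool → Coprod X Y → Prop
  | true => fun g => ∃ x, x ≠ 1 ∧ g = Coprod.inl x
  | false => fun g => ∃ y, y ≠ 1 ∧ g = Coprod.inr y

theorem coS_inv (X : Type u) (Y : Type v) [Group X] [Group Y] :
    ∀ i x, CoS X Y i x → CoS X Y i x⁻¹ := by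
  rintro (_ | _) _ ⟨x, hx, rfl⟩
  · exact ⟨x⁻¹, inv_ne_one.2 hx, by simp⟩
  · exact ⟨x⁻¹, inv_ne_one.2 hx, by simp⟩

theorem freePair_coprod (X : Type u) (Y : Type v) [Group X] [Group Y] : FreePair (CoS X Y) := by
  obtain ⟨G, _, p, q, -, hG⟩ := exists_amalgam (1 : Unit →* X) (1 : Unit →* Y)
    (fun _ _ _ => rfl) (fun _ _ _ => rfl)
  intro i j x h h1
  refine hG i j _ (h.map (Coprod.lift p q) ?_) (by rw [h1, map_one])
  rintro (_ | _) _ ⟨x, hx, rfl⟩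
  · exact ⟨x, by rintro ⟨_, h⟩; exact hx h.symm, by simp⟩
  · exact ⟨x, by rintro ⟨_, h⟩; exact hx h.symm, by simp⟩

theorem coprod_alt {X : Type u} {Y : Type v} [Group X] [Group Y] (z : Coprod X Y) :
    z = 1 ∨ ∃ i j, Alt (CoS X Y) i j z := by
  have main : ∀ i (s y : Coprod X Y), CoS X Y i s → (y = 1 ∨ ∃ i j, Alt (CoS X Y) i j y) →
      (s * y = 1 ∨ ∃ i j, Alt (CoS X Y) i j (s * y)) := by
    intro i s y hs hy
    have hmul : ∀ s s', CoS X Y i s → CoS X Y i s' → s * s' = 1 ∨ CoS X Y i (s * s') := by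
      rcases i with (_ | _)
      · rintro _ _ ⟨x, hx, rfl⟩ ⟨y, hy, rfl⟩
        by_cases h : x * y = 1
        · left; rw [← map_mul, h, map_one]
        · right; exact ⟨x * y, h, by simp⟩
      · rintro _ _ ⟨x, hx, rfl⟩ ⟨y, hy, rfl⟩
        by_cases h : x * y = 1
        · left; rw [← map_mul, h, map_one]
        · right; exact ⟨x * y, h, by simp⟩
    rcases hy with rfl | ⟨i', j, hy⟩
    · right; exact ⟨i, i, by simpa using Alt.single hs⟩
    · by_cases hii : i' = i
      · subst hii
        cases hy with
        | single hx =>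
          rcases hmul _ _ hs hx with h | h
          · left; exact h
          · right; exact ⟨_, _, .single h⟩
        | cons hx hy =>
          rw [← mul_assoc]
          rcases hmul _ _ hs hx with h | h
          · right; rw [h, one_mul]; exact ⟨_, _, hy⟩
          · right; exact ⟨_, _, .cons h hy⟩
      · have : i' = !i := by cases i <;> cases i' <;> simp_all
        subst this
        right; exact ⟨_, _, .cons hs hy⟩
  induction z using Coprod.induction_on' with
  | one => left; rfl
  | inl_mul m x ih =>
    by_cases hm : m = 1
    · simpa [hm] using ih
    · exact main true _ _ ⟨m, hm, rfl⟩ ih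
  | inr_mul m x ih =>
    by_cases hm : m = 1
    · simpa [hm] using ih
    · exact main false _ _ ⟨m, hm, rfl⟩ ih

theorem lift_injective {X : Type u} {Y : Type v} {M : Type w} [Group X] [Group Y] [Group M]
    (f : X →* M) (g : Y →* M) {S : Bool → M → Prop} (hS : FreePair S)
    (hf : ∀ x, x ≠ 1 → Alt S true true (f x)) (hg : ∀ y, y ≠ 1 → Alt S false false (g y)) :
    Function.Injective (Coprod.lift f g) := by
  rw [injective_iff_map_eq_one]
  intro z hz
  rcases coprod_alt z with h | ⟨i, j, h⟩
  · exact h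
  · exfalso
    let T : Bool → M → Prop := fun i m => Alt S i i m
    have : Alt T i j (Coprod.lift f g z) := h.map _ (by
      rintro (_ | _) _ ⟨x, hx, rfl⟩
      · simpa [T] using hg x hx
      · simpa [T] using hf x hx)
    exact hS i j _ (this.comp (fun _ _ h => h)) hz

/-- The infinite cyclic group. -/
abbrev Z := Multiplicative ℤ

/-- Its generator. -/
abbrev z1 : Z := Multiplicative.ofAdd 1

/-- The map from the free group on two letters to `M` with given images. -/
noncomputable def Lf {M : Type u} [Group M] (x y : M) : Coprod Z Z →* M :=
  Coprod.lift (zpowersHom M x) (zpowersHom M y)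

section
variable {M : Type u} {N : Type v} [Group M] [Group N]

@[simp] theorem Lf_inl (x y : M) : Lf x y (Coprod.inl z1) = x := by simp [Lf, z1]
@[simp] theorem Lf_inr (x y : M) : Lf x y (Coprod.inr z1) = y := by simp [Lf, z1]

theorem Lf_ext {f g : Coprod Z Z →* M} (h1 : f (Coprod.inl z1) = g (Coprod.inl z1))
    (h2 : f (Coprod.inr z1) = g (Coprod.inr z1)) : f = g := by
  apply Coprod.hom_ext
  · exact MonoidHom.ext_mint h1
  · exact MonoidHom.ext_mint h2

theorem Lf_mem (x y : M) (K : Subgroup M) (hx : x ∈ K) (hy : y ∈ K) (e : Coprod Z Z) :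
    Lf x y e ∈ K := by
  induction e using Coprod.induction_on' with
  | one => simp
  | inl_mul m x ih =>
    rw [map_mul]
    exact K.mul_mem (by simpa [Lf] using K.zpow_mem hx _) ih
  | inr_mul m x ih =>
    rw [map_mul]
    exact K.mul_mem (by simpa [Lf] using K.zpow_mem hy _) ih

theorem Lf_inj_change1 {x y : M} (h : Function.Injective (Lf x y)) :
    Function.Injective (Lf (x * y) x) := by
  have h1 : Lf (x * y) x = (Lf x y).comp (Lf (Coprod.inl z1 * Coprod.inr z1) (Coprod.inl z1)) :=
    Lf_ext (by simp) (by simp)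
  have h2 : (Lf (Coprod.inr z1) ((Coprod.inr z1)⁻¹ * Coprod.inl z1)).comp
      (Lf (Coprod.inl z1 * Coprod.inr z1) (Coprod.inl z1)) = MonoidHom.id (Coprod Z Z) :=
    Lf_ext (by simp) (by simp)
  rw [h1]
  exact h.comp (Function.LeftInverse.injective (fun e => DFunLike.congr_fun h2 e))

theorem Lf_inj_change2 {x y : M} (h : Function.Injective (Lf x y)) :
    Function.Injective (Lf (y * x) x⁻¹) := by
  have h1 : Lf (y * x) x⁻¹ =
      (Lf x y).comp (Lf (Coprod.inr z1 * Coprod.inl z1) (Coprod.inl z1)⁻¹) :=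
    Lf_ext (by simp) (by simp)
  have h2 : (Lf (Coprod.inr z1)⁻¹ (Coprod.inl z1 * Coprod.inr z1)).comp
      (Lf (Coprod.inr z1 * Coprod.inl z1) (Coprod.inl z1)⁻¹) = MonoidHom.id (Coprod Z Z) :=
    Lf_ext (by simp) (by simp)
  rw [h1]
  exact h.comp (Function.LeftInverse.injective (fun e => DFunLike.congr_fun h2 e))

theorem Lf_injective {x y : M} {S : Bool → M → Prop} (hS : FreePair S)
    (hx : ∀ k : ℤ, k ≠ 0 → Alt S true true (x ^ k))
    (hy : ∀ k : ℤ, k ≠ 0 → Alt S false false (y ^ k)) : Function.Injective (Lf x y) := by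
  apply lift_injective _ _ hS
  · intro k hk
    rw [zpowersHom_apply]
    exact hx _ (fun h => hk (Multiplicative.toAdd.injective h))
  · intro k hk
    rw [zpowersHom_apply]
    exact hy _ (fun h => hk (Multiplicative.toAdd.injective h))

end

theorem inl_zpow_coS (C : Type u) [Group C] (k : ℤ) (hk : k ≠ 0) :
    CoS Z C true ((Coprod.inl z1) ^ k) := by
  refine ⟨z1 ^ k, ?_, by simp⟩
  intro h
  apply hk
  have := congrArg Multiplicative.toAdd h
  simpa [z1] using this

/-- Injectivity for elements `d`, `a * d * b` of the free product. -/
theorem Lf_inj_coprod {C : Type u} [Group C] (a b : C) (ha : a ≠ 1) (hb : b ≠ 1) :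
    Function.Injective (Lf (Coprod.inl z1 : Coprod Z C)
      (Coprod.inr a * Coprod.inl z1 * Coprod.inr b)) := by
  refine Lf_injective (freePair_coprod Z C) ?_ ?_
  · intro k hk
    exact .single (inl_zpow_coS C k hk)
  · intro k hk
    refine pow_alt (S := CoS Z C) (i := false) (coS_inv Z C) ⟨a, ha, rfl⟩ ⟨b, hb, rfl⟩
      (fun k hk => inl_zpow_coS C k hk) ?_ k hk
    by_cases h : b * a = 1
    · left; rw [← map_mul, h, map_one]
    · right; exact ⟨b * a, h, by simp⟩

theorem not_range_omega {C : Type u} [Group C] (a b : C) (ha : a ≠ 1) (hb : b ≠ 1)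
    (hba : b * a ≠ 1) :
    (Coprod.inr b : Coprod Z C) ∉ (Lf (Coprod.inl z1 : Coprod Z C)
      (Coprod.inr a * Coprod.inl z1 * Coprod.inr b)).range ∧
    ∀ l : ℤ, l ≠ 0 → (Coprod.inr b)⁻¹ * (Coprod.inl z1 : Coprod Z C) ^ l * Coprod.inr b ∉
      (Lf (Coprod.inl z1 : Coprod Z C)
      (Coprod.inr a * Coprod.inl z1 * Coprod.inr b)).range := by
  classical
  let σC : C →* Equiv.Perm (C ⊕ ℤ) := (Equiv.Perm.sumCongrHom C ℤ).comp
    ((MonoidHom.inl (Equiv.Perm C) (Equiv.Perm ℤ)).comp (MulAction.toPermHom C C))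
  have hσC : ∀ c x : C, σC c (Sum.inl x) = Sum.inl (c * x) := fun c x => by
    simp [σC]
  let σ : Equiv.Perm (C ⊕ ℤ) := Equiv.sumCongr 1 (Equiv.addRight 1)
  let p : Equiv.Perm (C ⊕ ℤ) := Equiv.swap (Sum.inr 0) (Sum.inl b) *
    Equiv.swap (Sum.inr 1) (Sum.inl a⁻¹)
  have hba' : b ≠ a⁻¹ := fun h => hba (mul_eq_one_iff_eq_inv.2 h)
  have pb : p (Sum.inl b) = Sum.inr 0 := by
    simp only [p, Equiv.Perm.mul_apply]
    rw [Equiv.swap_apply_of_ne_of_ne (x := Sum.inl b) (by simp) (by simpa using hba')]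
    simp
  have pa : p (Sum.inl a⁻¹) = Sum.inr 1 := by
    simp only [p, Equiv.Perm.mul_apply]
    rw [Equiv.swap_apply_right]
    rw [Equiv.swap_apply_of_ne_of_ne (by simp) (by simp)]
  have p1 : p (Sum.inl 1) = Sum.inl 1 := by
    simp only [p, Equiv.Perm.mul_apply]
    rw [Equiv.swap_apply_of_ne_of_ne (x := Sum.inl 1) (by simp) (by simpa using ha)]
    rw [Equiv.swap_apply_of_ne_of_ne (by simp) (by simpa using hb.symm)]
  let D : Equiv.Perm (C ⊕ ℤ) := p⁻¹ * σ * p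
  have D1 : D (Sum.inl 1) = Sum.inl 1 := by
    simp only [D, Equiv.Perm.mul_apply, p1]
    rw [Equiv.Perm.inv_eq_iff_eq, p1]; simp [σ]
  have Db : D (Sum.inl b) = Sum.inl a⁻¹ := by
    simp only [D, Equiv.Perm.mul_apply, pb]
    rw [Equiv.Perm.inv_eq_iff_eq, pa]; simp [σ]
  have σl : ∀ l m : ℤ, (σ ^ l) (Sum.inr m) = Sum.inr (m + l) := by
    have h1 : ∀ m : ℤ, σ (Sum.inr m) = Sum.inr (m + 1) := fun m => by simp [σ]
    have h2 : ∀ m : ℤ, σ⁻¹ (Sum.inr m) = Sum.inr (m - 1) := fun m => by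
      rw [Equiv.Perm.inv_eq_iff_eq, h1]; simp
    intro l
    induction l using Int.induction_on with
    | zero => simp
    | succ i ih => intro m; rw [zpow_add_one, Equiv.Perm.mul_apply, h1, ih]; congr 1; ring
    | pred i ih => intro m; rw [zpow_sub_one, Equiv.Perm.mul_apply, h2, ih]; congr 1; ring
  have Dl : ∀ l : ℤ, l ≠ 0 → (D ^ l) (Sum.inl b) ≠ Sum.inl b := by
    intro l hl h
    have : D ^ l = p⁻¹ * σ ^ l * p := by
      have := conj_zpow (i := l) (a := p⁻¹) (b := σ)
      simpa [D] using this
    rw [this, Equiv.Perm.mul_apply, Equiv.Perm.mul_apply, pb, σl, Equiv.Perm.inv_eq_iff_eq,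
      pb] at h
    simp at h
    exact hl h
  let ρ : Coprod Z C →* Equiv.Perm (C ⊕ ℤ) := Coprod.lift (zpowersHom _ D) σC
  have ρz : ρ (Coprod.inl z1) = D := by simp [ρ, z1]
  have ρc : ∀ c, ρ (Coprod.inr c) = σC c := fun c => by simp [ρ]
  have fix : ∀ e, ρ (Lf (Coprod.inl z1 : Coprod Z C)
      (Coprod.inr a * Coprod.inl z1 * Coprod.inr b) e) (Sum.inl 1) = Sum.inl 1 := by
    intro e
    refine Lf_mem _ _ ((MulAction.stabilizer (Equiv.Perm (C ⊕ ℤ)) (Sum.inl 1 : C ⊕ ℤ)).comap ρ)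
      ?_ ?_ e
    · rw [Subgroup.mem_comap, MulAction.mem_stabilizer_iff, Equiv.Perm.smul_def, ρz, D1]
    · rw [Subgroup.mem_comap, MulAction.mem_stabilizer_iff, Equiv.Perm.smul_def, map_mul, map_mul,
        ρz, ρc, ρc, Equiv.Perm.mul_apply, Equiv.Perm.mul_apply, hσC, mul_one, Db, hσC,
        mul_inv_cancel]
  constructor
  · rintro ⟨e, he⟩
    have := fix e
    rw [he, ρc, hσC, mul_one] at this
    exact hb (Sum.inl_injective this)
  · rintro l hl ⟨e, he⟩
    have := fix e
    rw [he, map_mul, map_mul, map_inv, map_zpow, ρz, ρc, Equiv.Perm.mul_apply,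
      Equiv.Perm.mul_apply, hσC, mul_one, Equiv.Perm.inv_eq_iff_eq, hσC, mul_one] at this
    exact Dl l hl this

/-- The finite cyclic group. -/
abbrev W (n : ℕ) := Multiplicative (ZMod n)

/-- Its generator. -/
abbrev w1 (n : ℕ) : W n := Multiplicative.ofAdd 1

theorem w1_zpow (n : ℕ) (j : ℤ) : w1 n ^ j = 1 ↔ (n : ℤ) ∣ j := by
  rw [← ZMod.intCast_zmod_eq_zero_iff_dvd, ← ofAdd_zsmul]
  simp

theorem w1_ne (n : ℕ) (hn : 2 ≤ n) : w1 n ≠ 1 := by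
  intro h
  have := (w1_zpow n 1).1 (by simpa using h)
  have := Int.le_of_dvd one_pos this
  omega

theorem P_lemma (n : ℕ) (hn : 2 ≤ n) (s : Bool) : ∃ τ : Coprod Z (W n),
    Function.Injective (Lf (τ ^ 2)
      (if s then τ⁻¹ * Coprod.inr (w1 n) else τ * (Coprod.inr (w1 n))⁻¹)) ∧
    τ ∉ (Lf (τ ^ 2)
      (if s then τ⁻¹ * Coprod.inr (w1 n) else τ * (Coprod.inr (w1 n))⁻¹)).range ∧
    ∀ x : W n, x ≠ 1 → Coprod.inr x ∉ (Lf (τ ^ 2)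
      (if s then τ⁻¹ * Coprod.inr (w1 n) else τ * (Coprod.inr (w1 n))⁻¹)).range := by
  classical
  have hw := w1_ne n hn
  have inj := Lf_inj_coprod (w1 n) (w1 n) hw hw
  let D : Equiv.Perm (W n) := Equiv.swap (w1 n) (w1 n)⁻¹
  let ρ : Coprod Z (W n) →* Equiv.Perm (W n) :=
    Coprod.lift (zpowersHom _ D) (MulAction.toPermHom (W n) (W n))
  have ρz : ρ (Coprod.inl z1) = D := by simp [ρ, z1]
  have ρc : ∀ c x, ρ (Coprod.inr c) x = c * x := fun c x => by simp [ρ]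
  have D1 : D 1 = 1 := Equiv.swap_apply_of_ne_of_ne hw.symm (inv_ne_one.2 hw).symm
  have Dw : D (w1 n) = (w1 n)⁻¹ := Equiv.swap_apply_left _ _
  let K : Subgroup (Coprod Z (W n)) :=
    (MulAction.stabilizer (Equiv.Perm (W n)) (1 : W n)).comap ρ
  have hK : ∀ g, g ∈ K ↔ ρ g 1 = 1 := fun g => by
    rw [Subgroup.mem_comap, MulAction.mem_stabilizer_iff, Equiv.Perm.smul_def]
  have K1 : Coprod.inl z1 ∈ K := by rw [hK, ρz, D1]
  have K2 : Coprod.inr (w1 n) * Coprod.inl z1 * Coprod.inr (w1 n) ∈ K := by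
    rw [hK, map_mul, map_mul, Equiv.Perm.mul_apply, Equiv.Perm.mul_apply, ρz, ρc, ρc, mul_one, Dw,
      mul_inv_cancel]
  have Kx : ∀ x : W n, x ≠ 1 → Coprod.inr x ∉ K := fun x hx h => by
    rw [hK, ρc, mul_one] at h; exact hx h
  have Kt : Coprod.inl z1 * Coprod.inr (w1 n) ∉ K := by
    rw [K.mul_mem_cancel_left K1]; exact Kx _ hw
  have Kt' : Coprod.inr (w1 n) * Coprod.inl z1 ∉ K := by
    rw [K.mul_mem_cancel_right K1]; exact Kx _ hw
  cases s with
  | true =>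
    have e1 : (Coprod.inr (w1 n) * Coprod.inl z1) ^ 2 =
      (Coprod.inr (w1 n) * Coprod.inl z1 * Coprod.inr (w1 n)) * Coprod.inl z1 := by
        rw [pow_two]; simp only [mul_assoc]
    have e2 : (Coprod.inr (w1 n) * Coprod.inl z1)⁻¹ * Coprod.inr (w1 n) =
      (Coprod.inl z1 : Coprod Z (W n))⁻¹ := by group
    refine ⟨Coprod.inr (w1 n) * Coprod.inl z1, ?_⟩
    rw [if_pos rfl, e1, e2]
    refine ⟨Lf_inj_change2 inj, ?_, ?_⟩
    · rintro ⟨e, he⟩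
      exact Kt' (he ▸ Lf_mem _ _ K (K.mul_mem K2 K1) (K.inv_mem K1) e)
    · rintro x hx ⟨e, he⟩
      exact Kx x hx (he ▸ Lf_mem _ _ K (K.mul_mem K2 K1) (K.inv_mem K1) e)
  | false =>
    have e1 : (Coprod.inl z1 * Coprod.inr (w1 n)) ^ 2 =
      Coprod.inl z1 * (Coprod.inr (w1 n) * Coprod.inl z1 * Coprod.inr (w1 n)) := by
        rw [pow_two]; simp only [mul_assoc]
    have e2 : (Coprod.inl z1 * Coprod.inr (w1 n)) * (Coprod.inr (w1 n))⁻¹ =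
      (Coprod.inl z1 : Coprod Z (W n)) := by group
    refine ⟨Coprod.inl z1 * Coprod.inr (w1 n), ?_⟩
    rw [if_neg (by simp), e1, e2]
    refine ⟨Lf_inj_change1 inj, ?_, ?_⟩
    · rintro ⟨e, he⟩
      exact Kt (he ▸ Lf_mem _ _ K (K.mul_mem K1 K2) K1 e)
    · rintro x hx ⟨e, he⟩
      exact Kx x hx (he ▸ Lf_mem _ _ K (K.mul_mem K1 K2) K1 e)

/-- Letters of the final free product. -/
def FinS {G : Type u} [Group G] (t ω g : G) : Bool → G → Prop
  | true => fun x => ∃ k : ℤ, k ≠ 0 ∧ x = g⁻¹ * t ^ k * g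
  | false => fun x => ∃ j : ℤ, ω ^ j ≠ 1 ∧ x = ω ^ j

theorem exists_model {C : Type u} [Group C] (a b : C) (ha : a ≠ 1) (hb : b ≠ 1)
    (hba : b * a ≠ 1) (n : ℕ) (hn : 2 ≤ n) (s : Bool) :
    ∃ (G : Type u) (_ : Group G) (φ : C →* G) (t ω : G),
      (∀ j : ℤ, ω ^ j = 1 ↔ (n : ℤ) ∣ j) ∧
      φ a * t ^ 2 * φ b = (if s then t⁻¹ * ω else t * ω⁻¹) ∧
      FreePair (FinS t ω (φ b)) := by
  obtain ⟨τ, inj2, hτ, hω⟩ := P_lemma n hn s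
  obtain ⟨hb1, hbl⟩ := not_range_omega a b ha hb hba
  obtain ⟨G, _, p, q, hpq, hG⟩ := exists_amalgam _ _ (Lf_inj_coprod a b ha hb) inj2
  have r1 := hpq (Coprod.inl z1)
  have r2 := hpq (Coprod.inr z1)
  rw [Lf_inl, Lf_inl] at r1
  rw [Lf_inr, Lf_inr] at r2
  set d : Coprod Z C := Coprod.inl z1 with hd
  have hω' : ∀ j : ℤ, w1 n ^ j ≠ 1 → AmS (Lf d (Coprod.inr a * d * Coprod.inr b)) (Lf (τ ^ 2)
      (if s then τ⁻¹ * Coprod.inr (w1 n) else τ * (Coprod.inr (w1 n))⁻¹)) p q false (q (Coprod.inr (w1 n)) ^ j) :=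
    fun j hj => ⟨Coprod.inr (w1 n ^ j), hω _ hj, by simp⟩
  have hiff : ∀ j : ℤ, q (Coprod.inr (w1 n)) ^ j = 1 ↔ w1 n ^ j = 1 := by
    intro j
    constructor
    · intro h
      by_contra h'
      exact hG _ _ _ (.single (hω' j h')) h
    · intro h
      rw [← map_zpow, ← map_zpow, h, map_one, map_one]
  refine ⟨G, inferInstance, p.comp Coprod.inr, q τ, q (Coprod.inr (w1 n)), ?_, ?_, ?_⟩
  · intro j; rw [hiff, w1_zpow]
  · rw [map_mul, map_mul] at r2
    rw [MonoidHom.comp_apply, MonoidHom.comp_apply, ← map_pow, ← r1, r2]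
    cases s <;> simp
  · refine hG.comp ?_
    rintro (_ | _) _ ⟨k, hk, rfl⟩
    · exact .single (hω' k (fun h => hk ((hiff k).2 h)))
    · have hτ2 : ∀ l : ℤ, q τ ^ (2 * l) = p (d ^ l) := by
        intro l
        rw [zpow_mul, map_zpow, r1, map_pow]; norm_cast
      rcases Int.even_or_odd' k with ⟨l, rfl | rfl⟩
      · have hl : l ≠ 0 := by rintro rfl; simp at hk
        refine .single ⟨_, hbl l hl, ?_⟩
        rw [hτ2]; simp
      · have : (p.comp Coprod.inr b)⁻¹ * q τ ^ (2 * l + 1) * (p.comp Coprod.inr b) =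
            p ((Coprod.inr b)⁻¹ * d ^ l) * (q τ * p (Coprod.inr b)) := by
          rw [zpow_add, hτ2]; simp [mul_assoc]
        rw [this]
        refine .cons ⟨_, ?_, rfl⟩ (.cons ⟨τ, hτ, rfl⟩ (.single ⟨_, hb1, rfl⟩))
        have hdm : d ∈ (Lf d (Coprod.inr a * d * Coprod.inr b)).range :=
          ⟨Coprod.inl z1, Lf_inl _ _⟩
        rw [Subgroup.mul_mem_cancel_right _ (Subgroup.zpow_mem _ hdm l), Subgroup.inv_mem_iff]
        exact hb1

theorem exists_model2 {C : Type u} [Group C] (c₁ c₂ : C) (hc₁ : c₁ ≠ 1) (hc₂ : c₂ ≠ 1)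
    (hc₁c₂ : c₁ * c₂ ≠ 1) (n : ℕ) (hn : 2 ≤ n) (ε : ℤ) (hε : ε = 1 ∨ ε = -1) :
    ∃ (G : Type u) (_ : Group G) (φ : C →* G) (t ω g : G),
      (∀ j : ℤ, ω ^ j = 1 ↔ (n : ℤ) ∣ j) ∧
      g⁻¹ * (t ^ (2 * ε) * φ c₁ * t * φ c₂) * g = ω ∧
      FreePair (FinS t ω g) := by
  rcases hε with rfl | rfl
  · obtain ⟨G, _, φ, t, ω, h1, h2, h3⟩ := exists_model c₂ c₁ hc₂ hc₁ hc₁c₂ n hn true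
    rw [if_pos rfl] at h2
    refine ⟨G, inferInstance, φ, t, ω, t ^ 2 * φ c₁, h1, ?_, h3.comp ?_⟩
    · have : ω = t * (φ c₂ * t ^ 2 * φ c₁) := by rw [h2]; group
      rw [this]; group
    · rintro (_ | _) _ ⟨k, hk, rfl⟩
      · exact .single ⟨k, hk, rfl⟩
      · exact .single ⟨k, hk, by group⟩
  · obtain ⟨G, _, φ, t, ω, h1, h2, h3⟩ := exists_model c₁⁻¹ c₂⁻¹ (inv_ne_one.2 hc₁)
      (inv_ne_one.2 hc₂) (by rw [← mul_inv_rev]; exact inv_ne_one.2 hc₁c₂) n hn false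
    rw [if_neg (by simp)] at h2
    refine ⟨G, inferInstance, φ, t, ω, φ c₂⁻¹, h1, ?_, h3⟩
    have : ω = (φ c₁⁻¹ * t ^ 2 * φ c₂⁻¹)⁻¹ * t := by rw [h2]; group
    rw [this, map_inv, map_inv]; group

end RelPres

theorem relative_presentation_free_product_Z_Zn
    {C : Type*} [Group C] (c₁ c₂ : C) (hc₁ : c₁ ≠ 1) (hc₂ : c₂ ≠ 1)
    (hc₁c₂ : c₁ * c₂ ≠ 1) (n : ℕ) (hn : 2 ≤ n) (ε : ℤ) (hε : ε = 1 ∨ ε = -1) :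
    let F := Multiplicative ℤ
    let t : F := Multiplicative.ofAdd 1
    let r : Monoid.Coprod C F :=
      (Coprod.inr t) ^ (2 * ε) * Coprod.inl c₁ * Coprod.inr t * Coprod.inl c₂
    let π := QuotientGroup.mk' (Subgroup.normalClosure {r ^ n})
    orderOf (π (Coprod.inr t)) = 0 ∧
      orderOf (π r) = n ∧
      Function.Injective
        (Monoid.Coprod.lift (Subgroup.zpowers (π (Coprod.inr t))).subtype
          (Subgroup.zpowers (π r)).subtype) ∧
      Subgroup.closure {π (Coprod.inr t), π (Coprod.inl c₁ * Coprod.inr t * Coprod.inl c₂)} =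
        Subgroup.zpowers (π (Coprod.inr t)) ⊔ Subgroup.zpowers (π r) := by
  intro F t r π
  obtain ⟨G, _, φ, T, ω, g, h1, h2, h3⟩ :=
    RelPres.exists_model2 c₁ c₂ hc₁ hc₂ hc₁c₂ n hn ε hε
  let f : Coprod C F →* G := Coprod.lift φ (zpowersHom G T)
  have ft : f (Coprod.inr t) = T := by
    have : zpowersHom G T (Multiplicative.ofAdd 1) = T := by simp [zpowersHom_apply]
    exact (Coprod.lift_apply_inr _ _ _).trans this
  have fc : ∀ c, f (Coprod.inl c) = φ c := fun c => by simp [f]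
  have fr : f r = g * ω * g⁻¹ := by
    simp only [r, map_mul, map_zpow, ft, fc, ← h2]
    group
  have ωn : ω ^ n = 1 := by
    rw [← zpow_natCast, h1]
  have hker : Subgroup.normalClosure {r ^ n} ≤ f.ker := by
    apply Subgroup.normalClosure_le_normal
    rw [Set.singleton_subset_iff, SetLike.mem_coe, MonoidHom.mem_ker, map_pow, fr, conj_pow, ωn]
    simp
  let Ψ : Coprod C F ⧸ Subgroup.normalClosure {r ^ n} →* G :=
    (MulAut.conj g⁻¹).toMonoidHom.comp (QuotientGroup.lift _ f hker)
  have Ψπ : ∀ x, Ψ (π x) = g⁻¹ * f x * g := fun x => by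
    simp [Ψ, π]
  have Ψt : ∀ k : ℤ, Ψ (π (Coprod.inr t) ^ k) = g⁻¹ * T ^ k * g := fun k => by
    rw [← map_zpow, Ψπ, map_zpow, ft]
  have Ψr : ∀ k : ℤ, Ψ (π r ^ k) = ω ^ k := fun k => by
    rw [← map_zpow, Ψπ, map_zpow, fr, conj_zpow]; group
  have rn : π r ^ n = 1 := by
    rw [← map_pow]
    exact (QuotientGroup.eq_one_iff _).2 (Subgroup.subset_normalClosure rfl)
  have rdvd : ∀ k : ℤ, π r ^ k = 1 ↔ (n : ℤ) ∣ k := by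
    intro k
    constructor
    · intro h
      rw [← h1, ← Ψr, h, map_one]
    · rintro ⟨m, rfl⟩
      rw [zpow_mul, zpow_natCast, rn, one_zpow]
  have tk : ∀ k : ℤ, k ≠ 0 → RelPres.FinS T ω g true (Ψ (π (Coprod.inr t) ^ k)) :=
    fun k hk => ⟨k, hk, Ψt k⟩
  refine ⟨?_, ?_, ?_, ?_⟩
  · rw [orderOf_eq_zero_iff']
    intro k hk h
    refine h3 _ _ _ (.single (tk k (by exact_mod_cast hk.ne'))) ?_
    rw [zpow_natCast, h, map_one]
  · apply Nat.dvd_antisymm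
    · exact orderOf_dvd_of_pow_eq_one rn
    · rw [← Int.natCast_dvd_natCast, ← rdvd, zpow_natCast, pow_orderOf_eq_one]
  · have : Function.Injective (Coprod.lift
        (Ψ.comp (Subgroup.zpowers (π (Coprod.inr t))).subtype)
        (Ψ.comp (Subgroup.zpowers (π r)).subtype)) := by
      refine RelPres.lift_injective _ _ h3 ?_ ?_
      · rintro ⟨_, k, rfl⟩ hx
        refine .single (tk k ?_)
        rintro rfl
        exact hx (Subtype.ext (by simp))
      · rintro ⟨_, k, rfl⟩ hx
        refine .single ⟨k, ?_, Ψr k⟩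
        intro h
        rw [h1, ← rdvd] at h
        exact hx (Subtype.ext (by simpa using h))
    rw [← Coprod.comp_lift] at this
    rw [MonoidHom.coe_comp] at this
    exact Function.Injective.of_comp this
  · have hr : π r = π (Coprod.inr t) ^ (2 * ε) *
        π (Coprod.inl c₁ * Coprod.inr t * Coprod.inl c₂) := by
      rw [← map_zpow, ← map_mul]; simp only [r, mul_assoc]
    have hr' : π (Coprod.inl c₁ * Coprod.inr t * Coprod.inl c₂) =
        (π (Coprod.inr t) ^ (2 * ε))⁻¹ * π r := by rw [hr]; group
    apply le_antisymm
    · rw [Subgroup.closure_le]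
      rintro x (rfl | rfl)
      · exact Subgroup.mem_sup_left (Subgroup.mem_zpowers _)
      · rw [hr']
        exact Subgroup.mul_mem _ (Subgroup.inv_mem _ (Subgroup.zpow_mem _
          (Subgroup.mem_sup_left (Subgroup.mem_zpowers _)) _))
          (Subgroup.mem_sup_right (Subgroup.mem_zpowers _))
    · have m1 : π (Coprod.inr t) ∈ Subgroup.closure
          {π (Coprod.inr t), π (Coprod.inl c₁ * Coprod.inr t * Coprod.inl c₂)} :=
        Subgroup.subset_closure (Or.inl rfl)
      have m2 : π (Coprod.inl c₁ * Coprod.inr t * Coprod.inl c₂) ∈ Subgroup.closure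
          {π (Coprod.inr t), π (Coprod.inl c₁ * Coprod.inr t * Coprod.inl c₂)} :=
        Subgroup.subset_closure (Or.inr rfl)
      rw [sup_le_iff, Subgroup.zpowers_le, Subgroup.zpowers_le]
      refine ⟨m1, ?_⟩
      rw [hr]
      exact Subgroup.mul_mem _ (Subgroup.zpow_mem _ m1 _) m2
end
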